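/- arXiv:1404.4575 — 3 statements merged into one kernel-verified Lean document; each statement's English description precedes it below -/
import Mathlib

section
/- There exists an absolute constant C > 0 such that the following holds. For every finite set V with |V| = n ≥ 2, every family of unit vectors (x_u)_{u∈V} in a real inner product space satisfying ‖x_u − x_v‖² + ‖x_v − x_w‖² ≥ ‖x_u − x_w‖² for all u,v,w ∈ V, every β ∈ (0,1), and every real m ≥ 4, there exists a random assignment ω̃ : V → {0,1} such that: (i) for every u,v ∈ V with ‖x_u − x_v‖² ≥ β, Pr(ω̃(u) ≠ ω̃(v)) ≥ 1/2 − 1/log₂ m; and (ii) for every set e ⊆ V with |e| ≥ 2, Pr(ω̃(u) ≠ ω̃(v) for some u,v ∈ e) ≤ C·β^{-1}·√(log₂ n)·(log₂ log₂ m)·max_{u,v∈e} ‖x_u − x_v‖². -/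
open scoped Classical BigOperators RealInnerProductSpace

noncomputable section

/-- A hyperedge `e` is cut by a set `S` if `e ∩ S ≠ ∅` and `e \ S ≠ ∅`. -/
def Cuts {V : Type*} [DecidableEq V] (S e : Finset V) : Prop :=
  (e ∩ S).Nonempty ∧ (e \ S).Nonempty

/-- Number of hyperedges (indexed by `ι`) cut by `S`. -/
def cutCount {V ι : Type*} [DecidableEq V] [Fintype ι]
    (ed : ι → Finset V) (S : Finset V) : ℕ :=
  (Finset.univ.filter (fun i => Cuts S (ed i))).card

/-- `max_{u,v ∈ e} ‖x u - x v‖²`. -/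
def maxDistSq {V H : Type*} [NormedAddCommGroup H] (x : V → H) (e : Finset V) : ℝ :=
  sSup {d : ℝ | ∃ u ∈ e, ∃ v ∈ e, d = ‖x u - x v‖ ^ 2}

/-- `max_{u,v ∈ e} ‖x u - x v‖`. -/
def maxDist {V H : Type*} [NormedAddCommGroup H] (x : V → H) (e : Finset V) : ℝ :=
  sSup {d : ℝ | ∃ u ∈ e, ∃ v ∈ e, d = ‖x u - x v‖}

/-- `min_{w ∈ e} ‖x w‖`. -/
def minNorm {V H : Type*} [NormedAddCommGroup H] (x : V → H) (e : Finset V) : ℝ :=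
  sInf {d : ℝ | ∃ w ∈ e, d = ‖x w‖}

/-- SDP value of a vector solution. -/
def sdpValue {V ι H : Type*} [Fintype ι] [NormedAddCommGroup H]
    (ed : ι → Finset V) (x : V → H) : ℝ :=
  ∑ i : ι, maxDistSq x (ed i)

/-- Expansion of a set `S` in the hypergraph. -/
def expansion {V ι : Type*} [Fintype V] [DecidableEq V] [Fintype ι]
    (ed : ι → Finset V) (S : Finset V) : ℝ :=
  (cutCount ed S : ℝ) / min (S.card : ℝ) ((Sᶜ : Finset V).card : ℝ)

/-- Small set expansion `φ*_{H,δ}`. -/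
def phiStar {V ι : Type*} [Fintype V] [DecidableEq V] [Fintype ι]
    (ed : ι → Finset V) (δ : ℝ) : ℝ :=
  sInf {c : ℝ | ∃ S : Finset V, S.Nonempty ∧ (S.card : ℝ) ≤ δ * Fintype.card V ∧
                c = expansion ed S}

/-- Feasibility for the SDP relaxation of H-SSE with parameter `δ`. -/
def SDPFeasible {V H : Type*} [Fintype V] [NormedAddCommGroup H] [InnerProductSpace ℝ H]
    (x : V → H) (δ : ℝ) : Prop :=
  (∀ u : V, ∑ v : V, (⟪x u, x v⟫ : ℝ) ≤ δ * (Fintype.card V : ℝ) * ‖x u‖ ^ 2) ∧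
  (∑ u : V, ‖x u‖ ^ 2 = 1) ∧
  (∀ u v w : V, ‖x u - x w‖ ^ 2 ≤ ‖x u - x v‖ ^ 2 + ‖x v - x w‖ ^ 2) ∧
  (∀ u v : V, 0 ≤ (⟪x u, x v⟫ : ℝ) ∧ (⟪x u, x v⟫ : ℝ) ≤ ‖x u‖ ^ 2)

/-- The `ℓ2²`-triangle inequalities for a family of vectors. -/
def L22 {V H : Type*} [NormedAddCommGroup H] [InnerProductSpace ℝ H] (x : V → H) : Prop :=
  (∀ u v w : V, ‖x u - x w‖ ^ 2 ≤ ‖x u - x v‖ ^ 2 + ‖x v - x w‖ ^ 2) ∧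
  (∀ u v : V, 0 ≤ (⟪x u, x v⟫ : ℝ) ∧ (⟪x u, x v⟫ : ℝ) ≤ ‖x u‖ ^ 2)

/-- Probability of an event under a finitely supported distribution. -/
def Pr {Ω : Type*} [Fintype Ω] (μ : Ω → ℝ) (P : Ω → Prop) : ℝ :=
  ∑ ω : Ω, if P ω then μ ω else 0

/-- A finitely supported probability distribution. -/
def IsProbDist {Ω : Type*} [Fintype Ω] (μ : Ω → ℝ) : Prop :=
  (∀ ω, 0 ≤ μ ω) ∧ ∑ ω : Ω, μ ω = 1

/-- `η(u)` for a choice `c` of subsets `e° ⊆ e`. -/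
def eta {V ι : Type*} [Fintype ι] (ed c : ι → Finset V) (u : V) : ℝ :=
  ∑ i : ι, if u ∈ c i then Real.logb 2 ((ed i).card) / ((c i).card : ℝ) else 0

/-- `η̂(H)`: the minimum over all valid choices `(e°)_{e∈E}` of `max_{u∈V} η(u)`. -/
def etaHat {V ι : Type*} [Fintype V] [Fintype ι] (ed : ι → Finset V) : ℝ :=
  sInf {b : ℝ | ∃ c : ι → Finset V, (∀ i, c i ⊆ ed i ∧ (c i).Nonempty) ∧
                b = ⨆ u : V, eta ed c u}

/-- The sign `±1` encoded by a Boolean. -/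
def boolSign (b : Bool) : ℝ := if b then 1 else -1

/-- The Rademacher sum `∑ i, ± z i`. -/
def rad {N : ℕ} (z : Fin N → ℝ) (g : Fin N → Bool) : ℝ := ∑ i, boolSign (g i) * z i

/-- Negate all coordinates. -/
def flipAll {N : ℕ} (g : Fin N → Bool) : Fin N → Bool := fun i => !(g i)

/-- Negate one coordinate. -/
def flipAt {N : ℕ} (g : Fin N → Bool) (i : Fin N) : Fin N → Bool := Function.update g i (!(g i))

lemma rad_flipAll {N : ℕ} (z : Fin N → ℝ) (g : Fin N → Bool) : rad z (flipAll g) = -rad z g := by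
  unfold rad flipAll boolSign
  rw [← Finset.sum_neg_distrib]
  refine Finset.sum_congr rfl fun i _ => ?_
  cases g i <;> simp

lemma rad_sub {N : ℕ} (z w : Fin N → ℝ) (g : Fin N → Bool) :
    rad (fun i => z i - w i) g = rad z g - rad w g := by
  unfold rad
  rw [← Finset.sum_sub_distrib]
  exact Finset.sum_congr rfl fun i _ => by ring

lemma rad_cons {N : ℕ} (z : Fin (N + 1) → ℝ) (b : Bool) (g : Fin N → Bool) :
    rad z (Fin.cons b g) = boolSign b * z 0 + rad (fun i => z i.succ) g := by
  simp [rad, Fin.sum_univ_succ]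

lemma rad_sub_rad_flipAt {N : ℕ} (z : Fin N → ℝ) (g : Fin N → Bool) (i : Fin N) :
    rad z g - rad z (flipAt g i) = 2 * boolSign (g i) * z i := by
  unfold rad flipAt
  rw [← Finset.sum_sub_distrib, Finset.sum_eq_single i]
  · cases h : g i <;> simp [boolSign] <;> ring
  · intro j _ hj
    simp [Function.update_of_ne hj]
  · simp

lemma expect_cube_succ {N : ℕ} (F : (Fin (N + 1) → Bool) → ℝ) :
    𝔼 g, F g = ((𝔼 g : Fin N → Bool, F (Fin.cons true g)) +
      𝔼 g : Fin N → Bool, F (Fin.cons false g)) / 2 := by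
  have h : ∑ g, F g = ∑ g : Fin N → Bool, F (Fin.cons true g) +
      ∑ g : Fin N → Bool, F (Fin.cons false g) := by
    rw [← Equiv.sum_comp (Fin.consEquiv fun _ => Bool), Fintype.sum_prod_type, Fintype.sum_bool]
    rfl
  simp only [Fintype.expect_eq_sum_div_card, h]
  simp only [Fintype.card_pi, Fintype.card_bool, Finset.prod_const, Finset.card_univ,
    Fintype.card_fin]
  push_cast
  field_simp
  ring

lemma expect_flipAll {N : ℕ} (F : (Fin N → Bool) → ℝ) : 𝔼 g, F (flipAll g) = 𝔼 g, F g :=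
  Fintype.expect_equiv (Function.Involutive.toPerm flipAll fun g => by funext i; simp [flipAll]) _ _
    fun _ => rfl

lemma flipAt_flipAt {N : ℕ} (g : Fin N → Bool) (i : Fin N) : flipAt (flipAt g i) i = g := by
  simp [flipAt]

lemma expect_flipAt {N : ℕ} (F : (Fin N → Bool) → ℝ) (i : Fin N) :
    𝔼 g, F (flipAt g i) = 𝔼 g, F g :=
  Fintype.expect_equiv
    (Function.Involutive.toPerm (fun g => flipAt g i) fun g => flipAt_flipAt g i) _ _ fun _ => rfl

lemma expect_exp_rad_le {N : ℕ} (z : Fin N → ℝ) :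
    𝔼 g, Real.exp (rad z g) ≤ Real.exp ((∑ i, z i ^ 2) / 2) := by
  induction N with
  | zero => simp [rad]
  | succ N ih =>
    rw [expect_cube_succ]
    simp only [rad_cons, Real.exp_add, ← Finset.mul_expect, Fin.sum_univ_succ, add_div]
    rw [← add_div, ← add_mul, mul_div_right_comm]
    refine mul_le_mul ?_ (ih _) (Finset.expect_nonneg fun _ _ => (Real.exp_pos _).le)
      (Real.exp_pos _).le
    have := Real.cosh_le_exp_half_sq (z 0)
    rw [Real.cosh_eq] at this
    simpa [boolSign] using this

lemma expect_rad_sq {N : ℕ} (z : Fin N → ℝ) : 𝔼 g, rad z g ^ 2 = ∑ i, z i ^ 2 := by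
  induction N with
  | zero => simp [rad]
  | succ N ih =>
    rw [expect_cube_succ, ← Finset.expect_add_distrib, Fin.sum_univ_succ,
      ← ih (fun i => z i.succ), Finset.expect_div]
    rw [← Fintype.expect_const (ι := Fin N → Bool) (z 0 ^ 2), ← Finset.expect_add_distrib]
    refine Finset.expect_congr rfl fun g _ => ?_
    simp only [rad_cons, boolSign]
    simp
    ring

lemma expect_rad_four_le {N : ℕ} (z : Fin N → ℝ) :
    𝔼 g, rad z g ^ 4 ≤ 3 * (∑ i, z i ^ 2) ^ 2 := by
  induction N with
  | zero => simp [rad]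
  | succ N ih =>
    have h2 := expect_rad_sq (fun i => z i.succ)
    have h4 := ih (fun i => z i.succ)
    have key : 𝔼 g, rad z g ^ 4 = z 0 ^ 4 + 6 * z 0 ^ 2 * (𝔼 g, rad (fun i => z i.succ) g ^ 2) +
        𝔼 g, rad (fun i => z i.succ) g ^ 4 := by
      rw [expect_cube_succ, ← Finset.expect_add_distrib, Finset.expect_div, Finset.mul_expect,
        ← Fintype.expect_const (ι := Fin N → Bool) (z 0 ^ 4), ← Finset.expect_add_distrib,
        ← Finset.expect_add_distrib]
      refine Finset.expect_congr rfl fun g _ => ?_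
      simp only [rad_cons, boolSign]
      simp
      ring
    rw [key, h2, Fin.sum_univ_succ]
    nlinarith [sq_nonneg (z 0 ^ 2)]

/-- Paley–Zygmund for Rademacher sums. -/
lemma one_sixth_le_expect_rad {N : ℕ} (z : Fin N → ℝ) (hz : 1 ≤ ∑ i, z i ^ 2) :
    1 / 6 ≤ 𝔼 g, (if 1 / 2 ≤ |rad z g| then (1 : ℝ) else 0) := by
  set q := ∑ i, z i ^ 2 with hq
  set p := 𝔼 g, (if 1 / 2 ≤ |rad z g| then (1 : ℝ) else 0) with hp
  have hq0 : 0 < q := by linarith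
  have h2 := expect_rad_sq z
  have h4 := expect_rad_four_le z
  rw [← hq] at h2 h4
  have hle : 𝔼 g, rad z g ^ 2 ≤ 𝔼 g, (q / 4 + (12 * q)⁻¹ * rad z g ^ 4 +
      3 * q * (if 1 / 2 ≤ |rad z g| then (1 : ℝ) else 0)) := by
    refine Finset.expect_le_expect fun g _ => ?_
    split_ifs with h
    · have : (12 * q)⁻¹ * rad z g ^ 4 + 3 * q - rad z g ^ 2 =
          (12 * q)⁻¹ * (rad z g ^ 2 - 6 * q) ^ 2 := by
        field_simp
        ring
      have h' : 0 ≤ (12 * q)⁻¹ * (rad z g ^ 2 - 6 * q) ^ 2 := by positivity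
      linarith
    · have h1 : rad z g ^ 2 ≤ 1 / 4 := by
        rw [← sq_abs]
        nlinarith [abs_nonneg (rad z g)]
      have : 0 ≤ (12 * q)⁻¹ * rad z g ^ 4 := by positivity
      linarith
  rw [Finset.expect_add_distrib, Finset.expect_add_distrib, Fintype.expect_const,
    ← Finset.mul_expect, ← Finset.mul_expect, ← hp, h2] at hle
  have h5 : (12 * q)⁻¹ * (𝔼 g, rad z g ^ 4) ≤ q / 4 := by
    calc _ ≤ (12 * q)⁻¹ * (3 * q ^ 2) := by gcongr
      _ = q / 4 := by field_simp; norm_num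
  have : q * (1 / 6) ≤ q * p := by linarith
  exact le_of_mul_le_mul_left this hq0

lemma expect_sub_expect_sq {ι : Type*} [Fintype ι] [Nonempty ι] (F : ι → ℝ) :
    𝔼 g, (F g - 𝔼 h, F h) ^ 2 = 𝔼 g, F g ^ 2 - (𝔼 g, F g) ^ 2 := by
    simp only [sub_sq, Finset.expect_add_distrib, Finset.expect_sub_distrib,
      ← Finset.expect_mul, ← Finset.mul_expect, Fintype.expect_const]
    ring

lemma expect_sq_le {ι : Type*} [Fintype ι] [Nonempty ι] (F : ι → ℝ) :
    (𝔼 g, F g) ^ 2 ≤ 𝔼 g, F g ^ 2 := by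
  have h : 0 ≤ 𝔼 g, (F g - 𝔼 h, F h) ^ 2 := Finset.expect_nonneg fun _ _ => sq_nonneg _
  linarith [expect_sub_expect_sq F]

/-- The Poincaré (Efron–Stein) inequality on the discrete cube. -/
lemma cube_poincare {N : ℕ} (F : (Fin N → Bool) → ℝ) :
    𝔼 g, F g ^ 2 - (𝔼 g, F g) ^ 2 ≤ (∑ i, 𝔼 g, (F g - F (flipAt g i)) ^ 2) / 4 := by
  induction N with
  | zero => simp
  | succ N ih =>
    set A : (Fin N → Bool) → ℝ := fun g => F (Fin.cons true g)
    set B : (Fin N → Bool) → ℝ := fun g => F (Fin.cons false g)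
    have hA := ih A
    have hB := ih B
    have h0 : 𝔼 g, (F g - F (flipAt g 0)) ^ 2 = 𝔼 g, (A g - B g) ^ 2 := by
      rw [expect_cube_succ, ← Finset.expect_add_distrib, Finset.expect_div]
      refine Finset.expect_congr rfl fun g _ => ?_
      simp only [flipAt, Fin.cons_zero, Fin.update_cons_zero, A, B, Bool.not_true, Bool.not_false]
      ring
    have hs : ∀ i : Fin N, 𝔼 g, (F g - F (flipAt g i.succ)) ^ 2 =
        ((𝔼 g, (A g - A (flipAt g i)) ^ 2) + 𝔼 g, (B g - B (flipAt g i)) ^ 2) / 2 := by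
      intro i
      rw [expect_cube_succ]
      simp only [flipAt, Fin.cons_succ, ← Fin.cons_update, A, B]
    rw [Fin.sum_univ_succ, h0, Finset.sum_congr rfl fun i _ => hs i, ← Finset.sum_div,
      Finset.sum_add_distrib, expect_cube_succ, expect_cube_succ]
    have hJ := expect_sq_le fun g => A g - B g
    rw [Finset.expect_sub_distrib] at hJ
    change ((𝔼 g, A g ^ 2) + 𝔼 g, B g ^ 2) / 2 - (((𝔼 g, A g) + 𝔼 g, B g) / 2) ^ 2 ≤ _
    nlinarith

/-- The maximum of Rademacher sums has variance controlled by the largest individual variance. -/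
lemma variance_sup_rad_le {N : ℕ} {V : Type*} (J : Finset V) (hJ : J.Nonempty)
    (z : V → Fin N → ℝ) (D : ℝ) (hD : ∀ j ∈ J, ∑ i, z j i ^ 2 ≤ D) :
    𝔼 g, (J.sup' hJ (fun j => rad (z j) g) - 𝔼 h, J.sup' hJ (fun j => rad (z j) h)) ^ 2
      ≤ 2 * D := by
  set F : (Fin N → Bool) → ℝ := fun g => J.sup' hJ (fun j => rad (z j) g) with hF
  change 𝔼 g, (F g - 𝔼 h, F h) ^ 2 ≤ _
  rw [expect_sub_expect_sq]
  refine (cube_poincare F).trans ?_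
  have hpos : ∀ i, 𝔼 g, (F g - F (flipAt g i)) ^ 2 =
      2 * 𝔼 g, (max (F g - F (flipAt g i)) 0) ^ 2 := by
    intro i
    have h1 : 𝔼 g, (F g - F (flipAt g i)) ^ 2 =
        (𝔼 g, (max (F g - F (flipAt g i)) 0) ^ 2) +
          𝔼 g, (max (F (flipAt g i) - F g) 0) ^ 2 := by
      rw [← Finset.expect_add_distrib]
      refine Finset.expect_congr rfl fun g _ => ?_
      rcases le_total (F g) (F (flipAt g i)) with h | h
      · rw [max_eq_right (by linarith), max_eq_left (by linarith)]
        ring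
      · rw [max_eq_left (by linarith), max_eq_right (by linarith)]
        ring
    have h2 := expect_flipAt (fun g => (max (F g - F (flipAt g i)) 0) ^ 2) i
    simp only [flipAt_flipAt] at h2
    rw [h1, h2]
    ring
  have hsum : ∑ i, 𝔼 g, (max (F g - F (flipAt g i)) 0) ^ 2 ≤ 4 * D := by
    rw [← Finset.expect_sum_comm, ← Fintype.expect_const (ι := Fin N → Bool) (4 * D)]
    refine Finset.expect_le_expect fun g _ => ?_
    obtain ⟨j, hj, hjF⟩ := Finset.exists_mem_eq_sup' hJ (fun j => rad (z j) g)
    calc ∑ i, (max (F g - F (flipAt g i)) 0) ^ 2 ≤ ∑ i, 4 * z j i ^ 2 := by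
          refine Finset.sum_le_sum fun i _ => ?_
          have h1 : F g - F (flipAt g i) ≤ 2 * boolSign (g i) * z j i := by
            rw [← rad_sub_rad_flipAt]
            have : rad (z j) (flipAt g i) ≤ F (flipAt g i) :=
              Finset.le_sup' (fun j => rad (z j) (flipAt g i)) hj
            have h3 : F g = rad (z j) g := hjF
            linarith
          have h2 : max (F g - F (flipAt g i)) 0 ≤ 2 * |z j i| := by
            refine max_le (h1.trans ?_) (by positivity)
            cases g i <;> simp [boolSign]
            · linarith [neg_abs_le (z j i)]
            · exact le_abs_self _
          calc _ ≤ (2 * |z j i|) ^ 2 := by gcongr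
            _ = 4 * z j i ^ 2 := by rw [mul_pow, sq_abs]; norm_num
      _ = 4 * ∑ i, z j i ^ 2 := by rw [Finset.mul_sum]
      _ ≤ 4 * D := by linarith [hD j hj]
  rw [Finset.sum_congr rfl fun i _ => hpos i, ← Finset.mul_sum]
  linarith

lemma expect_sup_rad_le {N : ℕ} {V : Type*} (J : Finset V) (hJ : J.Nonempty)
    (z : V → Fin N → ℝ) (D : ℝ) (hD : ∀ j ∈ J, ∑ i, z j i ^ 2 ≤ D) (t : ℝ) :
    t * (𝔼 g, J.sup' hJ (fun j => rad (z j) g)) ≤ Real.log J.card + t ^ 2 * D / 2 := by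
  set F : (Fin N → Bool) → ℝ := fun g => J.sup' hJ (fun j => rad (z j) g) with hF
  have hc : (0 : ℝ) < J.card := by exact_mod_cast hJ.card_pos
  set A : ℝ := Real.log J.card + t ^ 2 * D / 2 with hA
  have hexp : 𝔼 g, Real.exp (t * F g) ≤ Real.exp A := by
    calc 𝔼 g, Real.exp (t * F g) ≤ 𝔼 g, ∑ j ∈ J, Real.exp (t * rad (z j) g) := by
          refine Finset.expect_le_expect fun g _ => ?_
          obtain ⟨j, hj, hjF⟩ := Finset.exists_mem_eq_sup' hJ (fun j => rad (z j) g)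
          have : F g = rad (z j) g := hjF
          rw [this]
          exact Finset.single_le_sum (f := fun j => Real.exp (t * rad (z j) g))
            (fun _ _ => (Real.exp_pos _).le) hj
      _ = ∑ j ∈ J, 𝔼 g, Real.exp (t * rad (z j) g) := Finset.expect_sum_comm _ _ _
      _ ≤ ∑ j ∈ J, Real.exp (t ^ 2 * D / 2) := by
          refine Finset.sum_le_sum fun j hj => ?_
          have h1 : ∀ g, t * rad (z j) g = rad (fun i => t * z j i) g := by
            intro g
            simp only [rad, Finset.mul_sum]
            exact Finset.sum_congr rfl fun i _ => by ring
          simp only [h1]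
          refine (expect_exp_rad_le _).trans (Real.exp_le_exp.2 ?_)
          simp only [mul_pow, ← Finset.mul_sum]
          have := mul_le_mul_of_nonneg_left (hD j hj) (sq_nonneg t)
          linarith
      _ = Real.exp A := by
          rw [Finset.sum_const, nsmul_eq_mul, hA, Real.exp_add, Real.exp_log hc]
  have hlin : ∀ g, t * F g ≤ A - 1 + Real.exp (-A) * Real.exp (t * F g) := by
    intro g
    rw [← Real.exp_add]
    linarith [Real.add_one_le_exp (-A + t * F g)]
  calc t * 𝔼 g, F g = 𝔼 g, t * F g := Finset.mul_expect _ _ _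
    _ ≤ 𝔼 g, (A - 1 + Real.exp (-A) * Real.exp (t * F g)) :=
        Finset.expect_le_expect fun g _ => hlin g
    _ = A - 1 + Real.exp (-A) * 𝔼 g, Real.exp (t * F g) := by
        rw [Finset.expect_add_distrib, Fintype.expect_const, Finset.mul_expect]
    _ ≤ A - 1 + Real.exp (-A) * Real.exp A := by gcongr
    _ = A := by rw [← Real.exp_add]; simp

/-- Every symmetric irreflexive relation with vertex capacities has a maximal symmetric fractional
matching: each edge has a saturated endpoint. -/
lemma exists_maximal_fractional_matching {V : Type*} [Fintype V] (E : V → V → Prop)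
    (hsymm : ∀ i j, E i j → E j i) (hirr : ∀ i, ¬E i i) (μ : V → ℝ) (hμ : ∀ i, 0 ≤ μ i) :
    ∃ m : V → V → ℝ, (∀ i j, 0 ≤ m i j) ∧ (∀ i j, m i j = m j i) ∧
      (∀ i j, ¬E i j → m i j = 0) ∧ (∀ i, ∑ j, m i j ≤ μ i) ∧
      ∀ i j, E i j → ∑ k, m i k = μ i ∨ ∑ k, m j k = μ j := by
  suffices h : ∀ S : Finset (V × V), ∃ m : V → V → ℝ, (∀ i j, 0 ≤ m i j) ∧
      (∀ i j, m i j = m j i) ∧ (∀ i j, ¬E i j → m i j = 0) ∧ (∀ i, ∑ j, m i j ≤ μ i) ∧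
      ∀ i j, (i, j) ∈ S → E i j → ∑ k, m i k = μ i ∨ ∑ k, m j k = μ j by
    obtain ⟨m, h1, h2, h3, h4, h5⟩ := h Finset.univ
    exact ⟨m, h1, h2, h3, h4, fun i j => h5 i j (Finset.mem_univ _)⟩
  intro S
  induction S using Finset.induction_on with
  | empty => exact ⟨fun _ _ => 0, by simp, by simp, by simp, by simpa using hμ, by simp⟩
  | insert p S _ ih =>
    obtain ⟨a, b⟩ := p
    obtain ⟨m, h1, h2, h3, h4, h5⟩ := ih
    by_cases hab : E a b
    swap
    · refine ⟨m, h1, h2, h3, h4, fun i j hij hE => ?_⟩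
      rcases Finset.mem_insert.1 hij with h | h
      · obtain ⟨rfl, rfl⟩ := Prod.mk.inj h
        exact absurd hE hab
      · exact h5 i j h hE
    have hne : a ≠ b := fun h => hirr a (by rwa [← h] at hab)
    set ε := min (μ a - ∑ k, m a k) (μ b - ∑ k, m b k) with hε
    have hεa : ε ≤ μ a - ∑ k, m a k := min_le_left _ _
    have hεb : ε ≤ μ b - ∑ k, m b k := min_le_right _ _
    have hε0 : 0 ≤ ε := le_min (by linarith [h4 a]) (by linarith [h4 b])
    set m' : V → V → ℝ := fun i j => m i j + (if i = a then if j = b then ε else 0 else 0) +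
      (if i = b then if j = a then ε else 0 else 0) with hm'
    have hdeg : ∀ i, ∑ j, m' i j = ∑ j, m i j + (if i = a then ε else 0) +
        (if i = b then ε else 0) := by
      intro i
      simp only [hm', Finset.sum_add_distrib]
      congr 1
      · congr 1
        split_ifs <;> simp
      · split_ifs <;> simp
    have hcap : ∀ i, ∑ j, m' i j ≤ μ i := by
      intro i
      rw [hdeg]
      by_cases hia : i = a
      · subst hia
        simp only [if_true, if_neg hne]
        linarith
      · by_cases hib : i = b
        · subst hib
          simp only [if_true, if_neg hia]
          linarith
        · simpa [hia, hib] using h4 i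
    have hmono : ∀ i, ∑ j, m i j ≤ ∑ j, m' i j := by
      intro i
      rw [hdeg]
      split_ifs <;> linarith
    refine ⟨m', ?_, ?_, ?_, hcap, ?_⟩
    · intro i j
      have := h1 i j
      simp only [hm']
      split_ifs <;> linarith
    · intro i j
      simp only [hm', h2 i j]
      by_cases h1 : i = a <;> by_cases h2 : i = b <;> by_cases h3 : j = a <;>
        by_cases h4 : j = b <;> simp [h1, h2, h3, h4, hne, hne.symm]
    · intro i j hij
      have e1 : ¬(i = a ∧ j = b) := by
        rintro ⟨rfl, rfl⟩
        exact hij hab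
      have e2 : ¬(i = b ∧ j = a) := by
        rintro ⟨rfl, rfl⟩
        exact hij (hsymm _ _ hab)
      simp only [hm', h3 i j hij]
      simp only [← ite_and, if_neg e1, if_neg e2]
      simp
    · intro i j hij hE
      rcases Finset.mem_insert.1 hij with h | h
      · obtain ⟨rfl, rfl⟩ := Prod.mk.inj h
        rw [hdeg, hdeg]
        simp only [if_true, if_neg hne, if_neg hne.symm]
        rcases min_choice (μ i - ∑ k, m i k) (μ j - ∑ k, m j k) with h | h
        · left
          rw [← hε] at h
          linarith
        · right
          rw [← hε] at h
          linarith
      · rcases h5 i j h hE with h | h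
        · exact Or.inl (le_antisymm (hcap i) (h ▸ hmono i))
        · exact Or.inr (le_antisymm (hcap j) (h ▸ hmono j))

/-- Squared Euclidean distance of two rows of `y`. -/
def sqd {V : Type*} {N : ℕ} (y : V → Fin N → ℝ) (u v : V) : ℝ := ∑ k, (y u k - y v k) ^ 2

lemma sqd_comm {V : Type*} {N : ℕ} (y : V → Fin N → ℝ) (u v : V) : sqd y u v = sqd y v u :=
  Finset.sum_congr rfl fun k _ => by ring

lemma sqd_self {V : Type*} {N : ℕ} (y : V → Fin N → ℝ) (u : V) : sqd y u u = 0 := by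
  simp [sqd]

/-- The `sqd`-ball of radius `r` around `i`, with the centre always included. -/
def sqBall {V : Type*} [Fintype V] {N : ℕ} (y : V → Fin N → ℝ) (r : ℝ) (i : V) : Finset V :=
  insert i (Finset.univ.filter fun j => sqd y j i ≤ r)

/-- The largest increase of the projection onto `g` within the ball of radius `r` around `i`. -/
def ballSup {V : Type*} [Fintype V] {N : ℕ} (y : V → Fin N → ℝ) (r : ℝ) (i : V)
    (g : Fin N → Bool) : ℝ :=
  (sqBall y r i).sup' (Finset.insert_nonempty _ _) fun j => rad (fun k => y j k - y i k) g

section Chaining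

variable {V : Type*} [Fintype V] {N : ℕ} {y : V → Fin N → ℝ}

lemma sqd_le_of_mem_sqBall {r : ℝ} (hr : 0 ≤ r) {i j : V} (hj : j ∈ sqBall y r i) :
    sqd y j i ≤ r := by
  rcases Finset.mem_insert.1 hj with rfl | h
  · rwa [sqd_self]
  · exact (Finset.mem_filter.1 h).2

lemma mem_sqBall {r : ℝ} {i j : V} (h : sqd y j i ≤ r) : j ∈ sqBall y r i :=
  Finset.mem_insert_of_mem (Finset.mem_filter.2 ⟨Finset.mem_univ _, h⟩)

lemma le_ballSup {r : ℝ} {i j : V} (h : j ∈ sqBall y r i) (g : Fin N → Bool) :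
    rad (y j) g - rad (y i) g ≤ ballSup y r i g := by
  rw [← rad_sub]
  exact Finset.le_sup' (fun j => rad (fun k => y j k - y i k) g) h

lemma exists_ballSup_eq (y : V → Fin N → ℝ) (r : ℝ) (i : V) (g : Fin N → Bool) :
    ∃ j ∈ sqBall y r i, ballSup y r i g = rad (y j) g - rad (y i) g := by
  obtain ⟨j, hj, h⟩ := Finset.exists_mem_eq_sup' (Finset.insert_nonempty i _ :
    (sqBall y r i).Nonempty) fun j => rad (fun k => y j k - y i k) g
  exact ⟨j, hj, h.trans (rad_sub _ _ _)⟩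

lemma ballSup_mono {r s : ℝ} (h : r ≤ s) (i : V) (g : Fin N → Bool) :
    ballSup y r i g ≤ ballSup y s i g := by
  refine Finset.sup'_mono _ (Finset.insert_subset_insert _ ?_) _
  exact Finset.monotone_filter_right _ fun j _ hj => le_trans hj h

lemma ballSup_add_le (htri : ∀ u v w, sqd y u w ≤ sqd y u v + sqd y v w) {r Δ σ : ℝ}
    (hr : 0 ≤ r) {i j : V} (hij : sqd y i j ≤ Δ) {g : Fin N → Bool}
    (hσ : σ ≤ rad (y j) g - rad (y i) g) :
    ballSup y r j g + σ ≤ ballSup y (r + Δ) i g := by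
  obtain ⟨l, hl, h⟩ := exists_ballSup_eq y r j g
  have h1 : l ∈ sqBall y (r + Δ) i := by
    refine mem_sqBall ((htri l j i).trans (add_le_add (sqd_le_of_mem_sqBall hr hl) ?_))
    rwa [sqd_comm]
  linarith [le_ballSup h1 g]

/-- One step of the chaining argument: large matchings in random directions make the expected
maximal projection grow. -/
lemma ballSup_chain_step (htri : ∀ u v w, sqd y u w ≤ sqd y u v + sqd y v w)
    {Δ σ κ : ℝ} (hσ : 0 < σ) (hκ : 0 < κ) (μ : V → ℝ)
    (hμ1 : ∑ i, μ i = 1) (m : (Fin N → Bool) → V → V → ℝ) (hm0 : ∀ g i j, 0 ≤ m g i j)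
    (hmsymm : ∀ g i j, m g i j = m g j i)
    (hmsupp : ∀ g i j, m g i j ≠ 0 → sqd y i j ≤ Δ ∧ σ ≤ |rad (y i) g - rad (y j) g|)
    (hmcap : ∀ g i, ∑ j, m g i j ≤ μ i) (hmflip : ∀ g, m (flipAll g) = m g)
    (hmκ : 2 * κ ≤ 𝔼 g, ∑ i, ∑ j, m g i j) {r : ℝ} (hr0 : 0 ≤ r) (hΔ : 0 ≤ Δ)
    (hr : 8 * r ≤ (σ * κ) ^ 2) :
    ∑ i, μ i * (𝔼 g, ballSup y r i g) + σ * κ / 2 ≤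
      ∑ i, μ i * (𝔼 g, ballSup y (r + Δ) i g) := by
  set up : (Fin N → Bool) → V → V → ℝ :=
    fun g i j => if rad (y i) g < rad (y j) g then m g i j else 0 with hup
  have hup0 : ∀ g i j, 0 ≤ up g i j := by
    intro g i j
    simp only [hup]
    split_ifs
    · exact hm0 g i j
    · exact le_rfl
  have hupσ : ∀ g i j, up g i j ≠ 0 → sqd y i j ≤ Δ ∧ σ ≤ rad (y j) g - rad (y i) g := by
    intro g i j h
    simp only [hup] at h
    split_ifs at h with hlt
    · obtain ⟨h1, h2⟩ := hmsupp g i j h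
      refine ⟨h1, ?_⟩
      rwa [abs_of_neg (by linarith), neg_sub] at h2
    · exact absurd rfl h
  have hsplit : ∀ g i j, m g i j = up g i j + up g j i := by
    intro g i j
    simp only [hup]
    rcases lt_trichotomy (rad (y i) g) (rad (y j) g) with h | h | h
    · simp [h, h.not_gt]
    · have : m g i j = 0 := by
        by_contra hne
        have := (hmsupp g i j hne).2
        rw [h, sub_self, abs_zero] at this
        linarith
      simp [h, this]
    · simp [h, h.not_gt, hmsymm g i j]
  set a : (Fin N → Bool) → V → ℝ := fun g i => ∑ j, up g i j with ha
  set b : (Fin N → Bool) → V → ℝ := fun g i => ∑ j, up g j i with hb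
  have hab : ∀ g i, a g i + b g i ≤ μ i := by
    intro g i
    rw [ha, hb, ← Finset.sum_add_distrib]
    simpa only [← hsplit] using hmcap g i
  have ha0 : ∀ g i, 0 ≤ a g i := fun g i => Finset.sum_nonneg fun j _ => hup0 g i j
  have hb0 : ∀ g i, 0 ≤ b g i := fun g i => Finset.sum_nonneg fun j _ => hup0 g j i
  have haflip : ∀ g i, a (flipAll g) i = b g i := by
    intro g i
    refine Finset.sum_congr rfl fun j _ => ?_
    simp only [hup, rad_flipAll, hmflip, neg_lt_neg_iff, hmsymm g i j]
  have hEab : ∀ i, 𝔼 g, b g i = 𝔼 g, a g i := by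
    intro i
    rw [← expect_flipAll (fun g => a g i)]
    exact Finset.expect_congr rfl fun g _ => (haflip g i).symm
  have hsize : ∀ g, ∑ i, ∑ j, m g i j = 2 * ∑ i, a g i := by
    intro g
    simp only [hsplit, Finset.sum_add_distrib]
    rw [Finset.sum_comm (f := fun i j => up g j i)]
    simp only [ha]
    ring
  have hpt : ∀ g, ∑ i, μ i * ballSup y r i g + σ * (∑ i, a g i) +
      ∑ i, (b g i - a g i) * ballSup y r i g ≤ ∑ i, μ i * ballSup y (r + Δ) i g := by
    intro g
    have h1 : ∀ i, ∑ j, up g i j * (ballSup y r j g + σ) + (μ i - a g i) * ballSup y r i g ≤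
        μ i * ballSup y (r + Δ) i g := by
      intro i
      have h2 : ∑ j, up g i j * (ballSup y r j g + σ) ≤ a g i * ballSup y (r + Δ) i g := by
        rw [ha, Finset.sum_mul]
        refine Finset.sum_le_sum fun j _ => ?_
        by_cases h0 : up g i j = 0
        · simp [h0]
        · obtain ⟨h3, h4⟩ := hupσ g i j h0
          exact mul_le_mul_of_nonneg_left (ballSup_add_le htri hr0 h3 h4) (hup0 g i j)
      have h3 : (μ i - a g i) * ballSup y r i g ≤ (μ i - a g i) * ballSup y (r + Δ) i g :=
        mul_le_mul_of_nonneg_left (ballSup_mono (by linarith) i g)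
          (by linarith [hab g i, hb0 g i])
      linarith
    have h4 := Finset.sum_le_sum fun i (_ : i ∈ Finset.univ) => h1 i
    refine le_trans (le_of_eq ?_) h4
    have h5 : ∑ i, ∑ j, up g i j * ballSup y r j g = ∑ i, b g i * ballSup y r i g := by
      rw [Finset.sum_comm]
      simp only [hb, Finset.sum_mul]
    have h6 : ∑ i, ∑ j, up g i j * σ = σ * ∑ i, a g i := by
      simp only [ha, ← Finset.sum_mul]
      ring
    simp only [mul_add, Finset.sum_add_distrib, sub_mul, Finset.sum_sub_distrib, h5, h6]
    ring
  have hvar : ∀ i, -(μ i * (σ * κ / 2)) ≤ 𝔼 g, (b g i - a g i) * ballSup y r i g := by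
    intro i
    set M := 𝔼 g, ballSup y r i g with hM
    have hσκ : 0 < σ * κ := mul_pos hσ hκ
    have hV : 𝔼 g, (ballSup y r i g - M) ^ 2 ≤ 2 * r :=
      variance_sup_rad_le (sqBall y r i) (Finset.insert_nonempty _ _)
        (fun j k => y j k - y i k) r fun j hj => sqd_le_of_mem_sqBall hr0 hj
    have hμi : 0 ≤ μ i := by
      have := hab (fun _ => true) i
      linarith [ha0 (fun _ => true) i, hb0 (fun _ => true) i]
    have h1 : 𝔼 g, (b g i - a g i) * ballSup y r i g =
        𝔼 g, (b g i - a g i) * (ballSup y r i g - M) := by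
      simp only [mul_sub, Finset.expect_sub_distrib, ← Finset.expect_mul, sub_mul, hEab i]
      ring
    rw [h1]
    have h2 : ∀ g, -(μ i * ((σ * κ)⁻¹ * (ballSup y r i g - M) ^ 2 + σ * κ / 4)) ≤
        (b g i - a g i) * (ballSup y r i g - M) := by
      intro g
      set T := ballSup y r i g - M
      have h3 : |T| ≤ (σ * κ)⁻¹ * T ^ 2 + σ * κ / 4 := by
        have : (σ * κ)⁻¹ * T ^ 2 + σ * κ / 4 - |T| = (σ * κ)⁻¹ * (|T| - σ * κ / 2) ^ 2 := by
          rw [← sq_abs T]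
          field_simp
          ring
        have h' : 0 ≤ (σ * κ)⁻¹ * (|T| - σ * κ / 2) ^ 2 := by positivity
        linarith
      have h4 : |b g i - a g i| ≤ μ i := by
        rw [abs_le]
        constructor <;> linarith [hab g i, ha0 g i, hb0 g i]
      have h5 : |(b g i - a g i) * T| ≤ μ i * ((σ * κ)⁻¹ * T ^ 2 + σ * κ / 4) := by
        rw [abs_mul]
        exact mul_le_mul h4 h3 (abs_nonneg _) hμi
      linarith [neg_abs_le ((b g i - a g i) * T)]
    refine le_trans ?_ (Finset.expect_le_expect fun g _ => h2 g)
    rw [Finset.expect_neg_distrib, ← Finset.mul_expect, Finset.expect_add_distrib,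
      ← Finset.mul_expect, Fintype.expect_const]
    refine neg_le_neg (mul_le_mul_of_nonneg_left ?_ hμi)
    have : (σ * κ)⁻¹ * 𝔼 g, (ballSup y r i g - M) ^ 2 ≤ (σ * κ)⁻¹ * ((σ * κ) ^ 2 / 4) := by
      gcongr
      linarith
    have h' : (σ * κ)⁻¹ * ((σ * κ) ^ 2 / 4) = σ * κ / 4 := by field_simp
    linarith
  have hE := Finset.expect_le_expect fun g (_ : g ∈ Finset.univ) => hpt g
  simp only [Finset.expect_add_distrib, Finset.expect_sum_comm, ← Finset.mul_expect] at hE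
  have hv := Finset.sum_le_sum fun i (_ : i ∈ Finset.univ) => hvar i
  rw [Finset.sum_neg_distrib, ← Finset.sum_mul, hμ1] at hv
  have hκ2 : κ ≤ ∑ i, 𝔼 g, a g i := by
    simp only [hsize, ← Finset.mul_expect, Finset.expect_sum_comm] at hmκ
    linarith
  have := mul_le_mul_of_nonneg_left hκ2 hσ.le
  linarith

/-- The expected size of random matchings at distance scale `a ^ 2 / (16 √L)` is small. -/
lemma expect_matching_lt (htri : ∀ u v w, sqd y u w ≤ sqd y u v + sqd y v w)
    {L σ κ : ℝ} (hσ : 0 < σ) (hκ : 0 < κ) (hL1 : 1 ≤ L)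
    (hL : Real.log (Fintype.card V) < L) (μ : V → ℝ) (hμ0 : ∀ i, 0 ≤ μ i)
    (hμ1 : ∑ i, μ i = 1) (m : (Fin N → Bool) → V → V → ℝ) (hm0 : ∀ g i j, 0 ≤ m g i j)
    (hmsymm : ∀ g i j, m g i j = m g j i)
    (hmsupp : ∀ g i j, m g i j ≠ 0 →
      sqd y i j ≤ (σ * κ) ^ 2 / (16 * √L) ∧ σ ≤ |rad (y i) g - rad (y j) g|)
    (hmcap : ∀ g i, ∑ j, m g i j ≤ μ i) (hmflip : ∀ g, m (flipAll g) = m g) :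
    𝔼 g, ∑ i, ∑ j, m g i j < 2 * κ := by
  by_contra! hmκ
  set Δ := (σ * κ) ^ 2 / (16 * √L) with hΔ
  have ha : 0 < σ * κ := mul_pos hσ hκ
  have hs1 : 1 ≤ √L := Real.one_le_sqrt.2 hL1
  have hs2 : √L ^ 2 = L := Real.sq_sqrt (by linarith)
  have hΔ0 : 0 < Δ := by positivity
  set K := ⌊2 * √L⌋₊ with hK
  have hK1 : (K : ℝ) ≤ 2 * √L := Nat.floor_le (by positivity)
  have hK2 : √L ≤ K := by
    have := Nat.lt_floor_add_one (2 * √L)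
    rw [← hK] at this
    linarith
  have hKΔ : 8 * (K * Δ) ≤ (σ * κ) ^ 2 := by
    calc 8 * (K * Δ) ≤ 8 * (2 * √L * Δ) := by gcongr
      _ = (σ * κ) ^ 2 := by rw [hΔ]; field_simp; norm_num
  have hchain : ∀ k : ℕ, k ≤ K → k * (σ * κ / 2) ≤ ∑ i, μ i * (𝔼 g, ballSup y (k * Δ) i g) := by
    intro k
    induction k with
    | zero =>
      intro _
      simp only [Nat.cast_zero, zero_mul]
      refine Finset.sum_nonneg fun i _ => mul_nonneg (hμ0 i) (Finset.expect_nonneg fun g _ => ?_)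
      simpa using le_ballSup (y := y) (r := 0) (Finset.mem_insert_self i _) g
    | succ k ih =>
      intro hk
      have hkK : (k : ℝ) ≤ K := by exact_mod_cast (Nat.le_succ k).trans hk
      have h1 : 8 * (k * Δ) ≤ (σ * κ) ^ 2 := le_trans (by gcongr) hKΔ
      have h2 := ballSup_chain_step htri hσ hκ μ hμ1 m hm0 hmsymm hmsupp hmcap hmflip hmκ
        (r := k * Δ) (by positivity) hΔ0.le h1
      have h3 : ((k + 1 : ℕ) : ℝ) * Δ = k * Δ + Δ := by push_cast; ring
      rw [h3]
      have := ih ((Nat.le_succ k).trans hk)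
      push_cast
      linarith
  have hup : ∀ i, (4 * √L / (σ * κ)) * (𝔼 g, ballSup y (K * Δ) i g) ≤ Real.log (Fintype.card V) +
      (4 * √L / (σ * κ)) ^ 2 * (K * Δ) / 2 := by
    intro i
    have h1 := expect_sup_rad_le (sqBall y (K * Δ) i) (Finset.insert_nonempty _ _)
      (fun j k => y j k - y i k) (K * Δ)
      (fun j hj => sqd_le_of_mem_sqBall (by positivity) hj) (4 * √L / (σ * κ))
    refine h1.trans (add_le_add (Real.log_le_log ?_ ?_) le_rfl)
    · exact_mod_cast Finset.card_pos.2 (Finset.insert_nonempty _ _)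
    · exact_mod_cast Finset.card_le_univ _
  have h1 := Finset.sum_le_sum fun i (_ : i ∈ Finset.univ) =>
    mul_le_mul_of_nonneg_left (hup i) (hμ0 i)
  rw [← Finset.sum_mul, hμ1, one_mul] at h1
  have h2 : ∑ i, μ i * (4 * √L / (σ * κ) * 𝔼 g, ballSup y (K * Δ) i g) =
      4 * √L / (σ * κ) * ∑ i, μ i * (𝔼 g, ballSup y (K * Δ) i g) := by
    rw [Finset.mul_sum]
    exact Finset.sum_congr rfl fun i _ => by ring
  rw [h2] at h1
  have h3 : 2 * L ≤ 4 * √L / (σ * κ) * ∑ i, μ i * (𝔼 g, ballSup y (K * Δ) i g) := by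
    calc 2 * L = 4 * √L / (σ * κ) * (√L * (σ * κ / 2)) := by
          rw [← hs2]
          field_simp
          norm_num
      _ ≤ 4 * √L / (σ * κ) * (K * (σ * κ / 2)) := by gcongr
      _ ≤ _ := mul_le_mul_of_nonneg_left (hchain K le_rfl) (by positivity)
  have h4 : (4 * √L / (σ * κ)) ^ 2 * (K * Δ) / 2 ≤ L := by
    calc (4 * √L / (σ * κ)) ^ 2 * (K * Δ) / 2 ≤
          (4 * √L / (σ * κ)) ^ 2 * ((σ * κ) ^ 2 / 8) / 2 := by
          gcongr
          linarith
      _ = √L ^ 2 := by field_simp; norm_num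
      _ = L := hs2
  linarith

end Chaining

lemma one_sixteenth_le_expect_powerset (U F : Finset ℤ) (a : ℤ) (ha : a ∈ U) (hF : F ⊆ U)
    (haF : a ∉ F) (hcard : F.card = 3) :
    1 / 16 ≤ 𝔼 S ∈ U.powerset, (if a ∈ S ∧ Disjoint S F then (1 : ℝ) else 0) := by
  have hsub : ({a} : Finset ℤ) ⊆ U \ F := by
    simpa using ⟨ha, haF⟩
  have hfilter : U.powerset.filter (fun S => a ∈ S ∧ Disjoint S F) = Finset.Icc {a} (U \ F) := by
    ext S
    simp only [Finset.mem_filter, Finset.mem_powerset, Finset.mem_Icc,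
      Finset.singleton_subset_iff, Finset.subset_sdiff]
    tauto
  have hc := Finset.card_Icc_finset hsub
  have hU : U.card = (U \ F).card + 3 := by
    rw [← hcard, Finset.card_sdiff_add_card_eq_card hF]
  have hpos : 1 ≤ (U \ F).card := by simpa using Finset.card_le_card hsub
  obtain ⟨n, hn⟩ := Nat.exists_eq_add_of_le hpos
  rw [Finset.expect_eq_sum_div_card, Finset.sum_boole, hfilter, hc, Finset.card_powerset, hU, hn,
    Finset.card_singleton]
  push_cast
  rw [Nat.add_sub_cancel_left, show 1 + n + 3 = n + 4 by ring, pow_add, div_mul_eq_div_div,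
    div_self (by positivity)]
  norm_num

lemma floor_near {s t : ℝ} (h : |s - t| < 1 / 4) :
    ⌊4 * s⌋ ∈ ({⌊4 * t⌋ - 1, ⌊4 * t⌋, ⌊4 * t⌋ + 1} : Finset ℤ) := by
  obtain ⟨h1, h2⟩ := abs_lt.1 h
  have a1 := Int.floor_le (4 * s)
  have a2 := Int.lt_floor_add_one (4 * s)
  have b1 := Int.floor_le (4 * t)
  have b2 := Int.lt_floor_add_one (4 * t)
  have c1 : ⌊4 * s⌋ < ⌊4 * t⌋ + 2 := by
    have : (⌊4 * s⌋ : ℝ) < ((⌊4 * t⌋ + 2 : ℤ) : ℝ) := by push_cast; linarith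
    exact_mod_cast this
  have c2 : ⌊4 * t⌋ < ⌊4 * s⌋ + 2 := by
    have : (⌊4 * t⌋ : ℝ) < ((⌊4 * s⌋ + 2 : ℤ) : ℝ) := by push_cast; linarith
    exact_mod_cast this
  simp only [Finset.mem_insert, Finset.mem_singleton]
  omega

lemma floor_far {s t : ℝ} (h : 1 / 2 ≤ |s - t|) :
    ⌊4 * s⌋ ∉ ({⌊4 * t⌋ - 1, ⌊4 * t⌋, ⌊4 * t⌋ + 1} : Finset ℤ) := by
  have a1 := Int.floor_le (4 * s)
  have a2 := Int.lt_floor_add_one (4 * s)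
  have b1 := Int.floor_le (4 * t)
  have b2 := Int.lt_floor_add_one (4 * t)
  have key : ⌊4 * t⌋ + 1 < ⌊4 * s⌋ ∨ ⌊4 * s⌋ + 1 < ⌊4 * t⌋ := by
    rcases le_abs.1 h with h | h
    · left
      have : ((⌊4 * t⌋ + 1 : ℤ) : ℝ) < ⌊4 * s⌋ := by push_cast; linarith
      exact_mod_cast this
    · right
      have : ((⌊4 * s⌋ + 1 : ℤ) : ℝ) < ⌊4 * t⌋ := by push_cast; linarith
      exact_mod_cast this
  simp only [Finset.mem_insert, Finset.mem_singleton]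
  omega

/-- The distance scale at which pairs at `ℓ₂²`-distance at least `1` get separated. -/
def sepScale (L : ℝ) : ℝ := (1 / 4 * (1 / 48)) ^ 2 / (16 * √L)

/-- For any weights on pairs at distance at least `1`, some set `A` contains one endpoint and
stays far from the other endpoint, for a constant fraction of the weight. -/
lemma exists_separating_set {V : Type*} [Fintype V] [DecidableEq V] {N : ℕ} {y : V → Fin N → ℝ}
    (htri : ∀ u v w, sqd y u w ≤ sqd y u v + sqd y v w) {L : ℝ} (hL1 : 1 ≤ L)
    (hL : Real.log (Fintype.card V) < L) (w : V → V → ℝ) (hw0 : ∀ u v, 0 ≤ w u v)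
    (hw1 : ∑ u, ∑ v, w u v = 1) (hwfar : ∀ u v, w u v ≠ 0 → 1 ≤ sqd y u v) :
    ∃ A : Finset V, 1 / 192 ≤ ∑ u, ∑ v, w u v *
      (if u ∈ A ∧ ∀ a ∈ A, sepScale L ≤ sqd y a v then 1 else 0) := by
  set Δ := sepScale L with hΔ
  set μ : V → ℝ := fun i => (∑ j, w i j + ∑ j, w j i) / 2 with hμ
  have hμ0 : ∀ i, 0 ≤ μ i := fun i => div_nonneg (add_nonneg
    (Finset.sum_nonneg fun j _ => hw0 i j) (Finset.sum_nonneg fun j _ => hw0 j i)) (by norm_num)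
  have hμ1 : ∑ i, μ i = 1 := by
    simp only [hμ]
    rw [← Finset.sum_div, Finset.sum_add_distrib, hw1, Finset.sum_comm, hw1]
    norm_num
  have hmatch : ∀ R : {R : V → V → Prop // (∀ i j, R i j → R j i) ∧ ∀ i, ¬R i i},
      ∃ m : V → V → ℝ, (∀ i j, 0 ≤ m i j) ∧ (∀ i j, m i j = m j i) ∧
      (∀ i j, ¬R.1 i j → m i j = 0) ∧ (∀ i, ∑ j, m i j ≤ μ i) ∧
      ∀ i j, R.1 i j → ∑ k, m i k = μ i ∨ ∑ k, m j k = μ j :=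
    fun R => exists_maximal_fractional_matching R.1 R.2.1 R.2.2 μ hμ0
  choose M hM0 hMsymm hMsupp hMcap hMsat using hmatch
  set E : (Fin N → Bool) → {R : V → V → Prop // (∀ i j, R i j → R j i) ∧ ∀ i, ¬R i i} :=
    fun g => ⟨fun i j => sqd y i j ≤ Δ ∧ 1 / 4 ≤ |rad (y i) g - rad (y j) g|,
      fun i j h => ⟨by rw [sqd_comm]; exact h.1, by rw [abs_sub_comm]; exact h.2⟩, fun i h => by
        have := h.2
        rw [sub_self, abs_zero] at this
        linarith⟩ with hE
  have hEflip : ∀ g, E (flipAll g) = E g := by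
    intro g
    refine Subtype.ext (funext fun i => funext fun j => ?_)
    simp only [hE, rad_flipAll]
    rw [← abs_neg]
    ring_nf
  set W : (Fin N → Bool) → V → Prop := fun g i => ∑ k, M (E g) i k = μ i with hW
  have hsmall : 𝔼 g, ∑ i, ∑ j, M (E g) i j < 2 * (1 / 48) := by
    refine expect_matching_lt htri (L := L) (σ := 1 / 4) (κ := 1 / 48) (by norm_num) (by norm_num)
      hL1 hL μ hμ0 hμ1 (fun g => M (E g)) (fun g => hM0 _) (fun g => hMsymm _) ?_
      (fun g => hMcap _) fun g => by rw [hEflip]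
    intro g i j h
    by_contra hne
    exact h (hMsupp (E g) i j hne)
  have hlost : ∀ g, ∑ u, ∑ v, w u v * ((if W g u then 1 else 0) + if W g v then 1 else 0) ≤
      2 * ∑ i, ∑ j, M (E g) i j := by
    intro g
    have h1 : ∑ u, ∑ v, w u v * ((if W g u then (1 : ℝ) else 0) + if W g v then 1 else 0) =
        2 * ∑ i, μ i * (if W g i then 1 else 0) := by
      simp only [mul_add, Finset.sum_add_distrib]
      rw [Finset.sum_comm (f := fun u v => w u v * if W g v then (1 : ℝ) else 0)]
      rw [← Finset.sum_add_distrib, Finset.mul_sum]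
      refine Finset.sum_congr rfl fun i _ => ?_
      rw [← Finset.sum_mul, ← Finset.sum_mul]
      simp only [hμ]
      ring
    rw [h1]
    refine mul_le_mul_of_nonneg_left (Finset.sum_le_sum fun i _ => ?_) (by norm_num)
    split_ifs with h
    · rw [mul_one]
      exact h.ge
    · rw [mul_zero]
      exact Finset.sum_nonneg fun j _ => hM0 _ i j
  set far : (Fin N → Bool) → V → V → ℝ :=
    fun g u v => if 1 / 2 ≤ |rad (y u) g - rad (y v) g| then 1 else 0 with hfar
  have hfarE : ∀ u v, w u v * (1 / 6) ≤ w u v * 𝔼 g, far g u v := by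
    intro u v
    by_cases h0 : w u v = 0
    · simp [h0]
    · refine mul_le_mul_of_nonneg_left ?_ (hw0 u v)
      simpa only [hfar, rad_sub] using
        one_sixth_le_expect_rad (fun k => y u k - y v k) (hwfar u v h0)
  have htotal : 1 / 12 ≤ 𝔼 g, ∑ u, ∑ v, w u v *
      (far g u v - ((if W g u then 1 else 0) + if W g v then 1 else 0)) := by
    have h1 : 1 / 6 ≤ 𝔼 g, ∑ u, ∑ v, w u v * far g u v := by
      simp only [Finset.expect_sum_comm, ← Finset.mul_expect]
      calc (1 : ℝ) / 6 = ∑ u, ∑ v, w u v * (1 / 6) := by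
            simp only [← Finset.sum_mul, hw1, one_mul]
        _ ≤ _ := Finset.sum_le_sum fun u _ => Finset.sum_le_sum fun v _ => hfarE u v
    have h2 := Finset.expect_le_expect fun g (_ : g ∈ Finset.univ) => hlost g
    rw [← Finset.mul_expect] at h2
    simp only [mul_sub (w _ _), Finset.sum_sub_distrib, Finset.expect_sub_distrib]
    linarith
  obtain ⟨g, -, hg⟩ := Finset.exists_le_of_le_expect Finset.univ_nonempty htotal
  set c : V → ℤ := fun u => ⌊4 * rad (y u) g⌋ with hc
  set F : V → Finset ℤ := fun v => {c v - 1, c v, c v + 1} with hF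
  set U : Finset ℤ := Finset.univ.biUnion F with hU
  have hFU : ∀ v, F v ⊆ U := fun v => Finset.subset_biUnion_of_mem F (Finset.mem_univ v)
  have hcU : ∀ u, c u ∈ U := fun u => hFU u (by simp [hF])
  have hFcard : ∀ v, (F v).card = 3 := by
    intro v
    refine Finset.card_eq_three.2 ⟨c v - 1, c v, c v + 1, ?_, ?_, ?_, rfl⟩ <;> omega
  set A : Finset ℤ → Finset V := fun S => Finset.univ.filter fun u => ¬W g u ∧ c u ∈ S with hA
  have hkey : ∀ u v S, ¬W g u → ¬W g v →
      c u ∈ S → Disjoint S (F v) → u ∈ A S ∧ ∀ a ∈ A S, Δ ≤ sqd y a v := by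
    intro u v S hu hv huS hS
    refine ⟨by simp [hA, hu, huS], fun a ha => ?_⟩
    obtain ⟨haW, haS⟩ : ¬W g a ∧ c a ∈ S := by simpa [hA] using ha
    by_contra! hlt
    have hnE : ¬(E g).1 a v := fun h => (hMsat (E g) a v h).elim haW hv
    have hnear : |rad (y a) g - rad (y v) g| < 1 / 4 := by
      by_contra! hge
      exact hnE ⟨hlt.le, hge⟩
    exact Finset.disjoint_left.1 hS haS (floor_near hnear)
  have hfinal : 1 / 192 ≤ 𝔼 S ∈ U.powerset, ∑ u, ∑ v, w u v *
      (if u ∈ A S ∧ ∀ a ∈ A S, Δ ≤ sqd y a v then 1 else 0) := by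
    simp only [Finset.expect_sum_comm, ← Finset.mul_expect]
    calc (1 : ℝ) / 192 = 1 / 16 * (1 / 12) := by norm_num
      _ ≤ 1 / 16 * ∑ u, ∑ v, w u v *
          (far g u v - ((if W g u then 1 else 0) + if W g v then 1 else 0)) := by gcongr
      _ = ∑ u, ∑ v, w u v * (1 / 16 *
          (far g u v - ((if W g u then 1 else 0) + if W g v then 1 else 0))) := by
          simp only [Finset.mul_sum]
          exact Finset.sum_congr rfl fun u _ => Finset.sum_congr rfl fun v _ => by ring
      _ ≤ _ := by
          refine Finset.sum_le_sum fun u _ => Finset.sum_le_sum fun v _ =>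
            mul_le_mul_of_nonneg_left ?_ (hw0 u v)
          by_cases hgood : 1 / 2 ≤ |rad (y u) g - rad (y v) g| ∧ ¬W g u ∧ ¬W g v
          · obtain ⟨h1, h2, h3⟩ := hgood
            have h4 := one_sixteenth_le_expect_powerset U (F v) (c u) (hcU u) (hFU v)
              (floor_far h1) (hFcard v)
            simp only [hfar, if_pos h1, if_neg h2, if_neg h3]
            norm_num
            norm_num at h4
            refine h4.trans (Finset.expect_le_expect fun S _ => ?_)
            by_cases hS : c u ∈ S ∧ Disjoint S (F v)
            · rw [if_pos hS, if_pos (hkey u v S h2 h3 hS.1 hS.2)]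
            · rw [if_neg hS]
              split_ifs <;> norm_num
          · refine le_trans ?_ (Finset.expect_nonneg fun S _ => ?_)
            · have : far g u v - ((if W g u then 1 else 0) + if W g v then 1 else 0) ≤ 0 := by
                simp only [hfar]
                split_ifs <;> first | exact absurd ⟨‹_›, ‹_›, ‹_›⟩ hgood | norm_num
              linarith
            · split_ifs <;> norm_num
  obtain ⟨S, -, hS⟩ := Finset.exists_le_of_le_expect (Finset.powerset_nonempty U) hfinal
  exact ⟨A S, hS⟩

/-- Von Neumann's minimax theorem for finite games, in the form used here. -/
lemma exists_mixed_strategy {A P : Type*} [Fintype A] [Nonempty A] [Fintype P]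
    (a : A → P → ℝ) (c : ℝ)
    (h : ∀ w : P → ℝ, (∀ p, 0 ≤ w p) → ∑ p, w p = 1 → ∃ i, c ≤ ∑ p, w p * a i p) :
    ∃ l : A → ℝ, (∀ i, 0 ≤ l i) ∧ ∑ i, l i = 1 ∧ ∀ p, c ≤ ∑ i, l i * a i p := by
  by_contra! hcon
  set T : (A → ℝ) →ₗ[ℝ] (P → ℝ) :=
    { toFun := fun l p => ∑ i, l i * a i p
      map_add' := fun l l' => by
        funext p
        simp [add_mul, Finset.sum_add_distrib]
      map_smul' := fun r l => by
        funext p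
        simp [Finset.mul_sum, mul_assoc] } with hT
  have hTcont : Continuous T := LinearMap.continuous_of_finiteDimensional T
  set C : Set (P → ℝ) := T '' stdSimplex ℝ A
  set D : Set (P → ℝ) := {y | ∀ p, c ≤ y p} with hDdef
  have hCc : Convex ℝ C := (convex_stdSimplex ℝ A).linear_image T
  have hCk : IsCompact C := (isCompact_stdSimplex ℝ A).image hTcont
  have hDc : Convex ℝ D := by
    intro x hx y hy s t hs ht hst p
    have h1 := mul_le_mul_of_nonneg_left (hx p) hs
    have h2 := mul_le_mul_of_nonneg_left (hy p) ht
    simp only [Pi.add_apply, Pi.smul_apply, smul_eq_mul]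
    calc c = s * c + t * c := by rw [← add_mul, hst, one_mul]
      _ ≤ _ := add_le_add h1 h2
  have hDcl : IsClosed D := by
    simp only [hDdef, Set.ofPred_forall]
    exact isClosed_iInter fun p => isClosed_le continuous_const (continuous_apply p)
  have hdisj : Disjoint C D := by
    rw [Set.disjoint_left]
    rintro _ ⟨l, ⟨hl0, hl1⟩, rfl⟩ hD
    obtain ⟨p, hp⟩ := hcon l hl0 hl1
    exact absurd (hD p) (not_le.2 hp)
  obtain ⟨f, s, t, hfC, hst, hfD⟩ := geometric_hahn_banach_compact_closed hCc hCk hDc hDcl hdisj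
  set b : P → ℝ := fun p => f (Pi.single p 1) with hb
  have hf : ∀ y : P → ℝ, f y = ∑ p, b p * y p := by
    intro y
    conv_lhs => rw [pi_eq_sum_univ' y]
    rw [map_sum]
    refine Finset.sum_congr rfl fun p _ => ?_
    rw [map_smul, smul_eq_mul, mul_comm]
  have hb0 : ∀ p, 0 ≤ b p := by
    intro p
    by_contra! hneg
    set r : ℝ := max 0 ((t - f fun _ => c) / b p) with hr
    have h1 : (fun _ => c) + r • Pi.single p 1 ∈ D := by
      intro q
      have : 0 ≤ r * (Pi.single p 1 : P → ℝ) q :=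
        mul_nonneg (le_max_left _ _) (by rw [Pi.single_apply]; split_ifs <;> norm_num)
      simpa using this
    have h2 := hfD _ h1
    rw [map_add, map_smul, smul_eq_mul] at h2
    have h3 : r * b p ≤ t - f fun _ => c := by
      have := mul_le_mul_of_nonpos_right (le_max_right 0 ((t - f fun _ => c) / b p)) hneg.le
      rwa [div_mul_cancel₀ _ hneg.ne] at this
    have h4 : f (Pi.single p 1) = b p := rfl
    rw [h4] at h2
    linarith
  have hlt : ∀ i, ∑ p, b p * a i p < c * ∑ p, b p := by
    intro i
    have h1 := hfC (T (Pi.single i 1)) ⟨_, single_mem_stdSimplex ℝ i, rfl⟩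
    have h2 := hfD (fun _ => c) fun _ => le_rfl
    rw [hf] at h1 h2
    have h3 : ∀ p, T (Pi.single i 1) p = a i p := by
      intro p
      change ∑ j, (Pi.single i 1 : A → ℝ) j * a j p = a i p
      simp [Pi.single_apply]
    simp only [h3] at h1
    rw [Finset.mul_sum]
    simp only [mul_comm c]
    linarith
  have hB : 0 < ∑ p, b p := by
    refine lt_of_le_of_ne (Finset.sum_nonneg fun p _ => hb0 p) fun h0 => ?_
    have hz := (Finset.sum_eq_zero_iff_of_nonneg fun p _ => hb0 p).1 h0.symm
    obtain ⟨i⟩ := ‹Nonempty A›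
    have := hlt i
    rw [← h0, mul_zero, Finset.sum_eq_zero fun p hp => by rw [hz p hp, zero_mul]] at this
    exact lt_irrefl _ this
  obtain ⟨i, hi⟩ := h (fun p => b p / ∑ q, b q) (fun p => div_nonneg (hb0 p) hB.le)
    (by rw [← Finset.sum_div, div_self hB.ne'])
  have h1 : ∑ p, b p / (∑ q, b q) * a i p = (∑ p, b p * a i p) / ∑ q, b q := by
    rw [Finset.sum_div]
    exact Finset.sum_congr rfl fun p _ => by ring
  rw [h1, le_div_iff₀ hB] at hi
  exact absurd (hlt i) (not_lt.2 hi)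

section Distributions

variable {Ω : Type*} [Fintype Ω]

lemma pr_nonneg {ν : Ω → ℝ} (hν : IsProbDist ν) (P : Ω → Prop) : 0 ≤ Pr ν P :=
  Finset.sum_nonneg fun ω _ => by split_ifs <;> simp [hν.1 ω]

lemma pr_le_one {ν : Ω → ℝ} (hν : IsProbDist ν) (P : Ω → Prop) : Pr ν P ≤ 1 := by
  rw [← hν.2]
  exact Finset.sum_le_sum fun ω _ => by split_ifs <;> simp [hν.1 ω]

lemma pr_mixture {ι : Type*} [Fintype ι] (l : ι → ℝ) (ν : ι → Ω → ℝ) (P : Ω → Prop) :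
    Pr (fun ω => ∑ i, l i * ν i ω) P = ∑ i, l i * Pr (ν i) P := by
  simp only [Pr, Finset.mul_sum]
  rw [Finset.sum_comm]
  refine Finset.sum_congr rfl fun ω _ => ?_
  split_ifs <;> simp

lemma isProbDist_mixture {ι : Type*} [Fintype ι] {l : ι → ℝ} {ν : ι → Ω → ℝ}
    (hl0 : ∀ i, 0 ≤ l i) (hl1 : ∑ i, l i = 1) (hν : ∀ i, IsProbDist (ν i)) :
    IsProbDist fun ω => ∑ i, l i * ν i ω := by
  refine ⟨fun ω => Finset.sum_nonneg fun i _ => mul_nonneg (hl0 i) ((hν i).1 ω), ?_⟩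
  rw [Finset.sum_comm]
  simp only [← Finset.mul_sum, (hν _).2, mul_one, hl1]

/-- The point mass at `a`. -/
def pointMass (a : Ω) : Ω → ℝ := fun ω => if ω = a then 1 else 0

lemma isProbDist_pointMass (a : Ω) : IsProbDist (pointMass a) :=
  ⟨fun ω => by unfold pointMass; split_ifs <;> norm_num, by simp [pointMass]⟩

lemma pr_pointMass (a : Ω) (P : Ω → Prop) : Pr (pointMass a) P = if P a then 1 else 0 := by
  rw [Pr, Finset.sum_eq_single a]
  · simp [pointMass]
  · intro ω _ h
    simp [pointMass, h]
  · simp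

/-- Pushforward of a probability measure to a finite type. -/
lemma exists_probDist_of_measure {S : Type*} [MeasurableSpace S] (ρ : MeasureTheory.Measure S)
    [MeasureTheory.IsProbabilityMeasure ρ] (Φ : S → Ω)
    (hΦ : ∀ ω, MeasurableSet (Φ ⁻¹' {ω})) :
    ∃ ν : Ω → ℝ, IsProbDist ν ∧ ∀ P : Ω → Prop, Pr ν P = ρ.real {s | P (Φ s)} := by
  have hPr : ∀ P : Ω → Prop, Pr (fun ω => ρ.real (Φ ⁻¹' {ω})) P = ρ.real {s | P (Φ s)} := by
    intro P
    have hset : {s | P (Φ s)} = ⋃ ω ∈ Finset.univ.filter P, Φ ⁻¹' {ω} := by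
      ext s
      simp
    rw [hset, MeasureTheory.measureReal_biUnion_finset, Pr, Finset.sum_filter]
    · intro ω _ ω' _ hne
      exact Disjoint.preimage _ (by simpa using hne)
    · exact fun ω _ => hΦ ω
  refine ⟨_, ⟨fun ω => MeasureTheory.measureReal_nonneg, ?_⟩, hPr⟩
  have := hPr fun _ => True
  simpa [Pr] using this

variable {V : Type*} [Fintype V] [DecidableEq V]

/-- Thresholding a real function at a uniformly random level. -/
lemma exists_threshold_probDist (f : V → ℝ) {Δ : ℝ} (hΔ : 0 < Δ) :
    ∃ ν : (V → Bool) → ℝ, IsProbDist ν ∧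
      (∀ u v, f u ≤ 0 → Δ ≤ f v → Pr ν (fun ω => ω u ≠ ω v) = 1) ∧
      ∀ (e : Finset V) (D : ℝ), 0 ≤ D → (∀ u ∈ e, ∀ v ∈ e, f v - f u ≤ D) →
        Pr ν (fun ω => ∃ u ∈ e, ∃ v ∈ e, ω u ≠ ω v) ≤ D / Δ := by
  set ρ : MeasureTheory.Measure ℝ := ProbabilityTheory.cond MeasureTheory.volume (Set.Ioc 0 Δ)
  have hvol : MeasureTheory.volume (Set.Ioc 0 Δ) = ENNReal.ofReal Δ := by simp
  have : MeasureTheory.IsProbabilityMeasure ρ :=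
    ProbabilityTheory.cond_isProbabilityMeasure_of_finite (by simp [hvol, hΔ]) (by simp [hvol])
  have hρ : ∀ s : Set ℝ, ρ.real s = Δ⁻¹ * MeasureTheory.volume.real (Set.Ioc 0 Δ ∩ s) := by
    intro s
    simp only [ρ, MeasureTheory.measureReal_def, ProbabilityTheory.cond_apply measurableSet_Ioc,
      hvol, ENNReal.toReal_mul, ENNReal.toReal_inv, ENNReal.toReal_ofReal hΔ.le]
  obtain ⟨ν, hν, hPr⟩ := exists_probDist_of_measure ρ (fun s (u : V) => decide (f u < s)) (by
    intro ω
    have : (fun s (u : V) => decide (f u < s)) ⁻¹' {ω} =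
        ⋂ u, {s : ℝ | decide (f u < s) = ω u} := by
      ext s
      simp [funext_iff]
    rw [this]
    refine MeasurableSet.iInter fun u => ?_
    cases h : ω u
    · rw [show {s : ℝ | decide (f u < s) = false} = Set.Iic (f u) by ext; simp]
      exact measurableSet_Iic
    · rw [show {s : ℝ | decide (f u < s) = true} = Set.Ioi (f u) by ext; simp]
      exact measurableSet_Ioi)
  refine ⟨ν, hν, fun u v hu hv => ?_, fun e D hD0 hD => ?_⟩
  · rw [hPr, hρ]
    have : Set.Ioc 0 Δ ∩ {s | decide (f u < s) ≠ decide (f v < s)} = Set.Ioc 0 Δ := by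
      refine Set.inter_eq_left.2 fun s hs => ?_
      have h1 : f u < s := hu.trans_lt hs.1
      have h2 : ¬f v < s := not_lt.2 (hs.2.trans hv)
      simp [h1, h2]
    rw [this]
    simp [hΔ.le, hΔ.ne']
  · rw [hPr, hρ, div_eq_inv_mul]
    refine mul_le_mul_of_nonneg_left ?_ (by positivity)
    rcases e.eq_empty_or_nonempty with rfl | he
    · simpa using hD0
    obtain ⟨a, ha, hamin⟩ := e.exists_min_image f he
    obtain ⟨b, hb, hbmax⟩ := e.exists_max_image f he
    calc _ ≤ MeasureTheory.volume.real (Set.Ioc (f a) (f b)) := by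
          refine MeasureTheory.measureReal_mono ?_ (by simp)
          rintro s ⟨-, u, hu, v, hv, huv⟩
          have : (f u < s ∧ s ≤ f v) ∨ (f v < s ∧ s ≤ f u) := by
            by_cases h1 : f u < s <;> by_cases h2 : f v < s <;> simp [h1, h2] at huv ⊢
            · exact not_lt.1 h2
            · exact not_lt.1 h1
          rcases this with h | h
          · exact ⟨(hamin u hu).trans_lt h.1, h.2.trans (hbmax v hv)⟩
          · exact ⟨(hamin v hv).trans_lt h.1, h.2.trans (hbmax u hu)⟩
      _ = f b - f a := by simp [hamin b hb]
      _ ≤ D := hD a ha b hb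

/-- The distribution of the pointwise XOR of two independent samples. -/
def xorConv (ν ν' : (V → Bool) → ℝ) : (V → Bool) → ℝ := fun ω =>
  ∑ p : (V → Bool) × (V → Bool), ν p.1 * ν' p.2 * pointMass (fun u => xor (p.1 u) (p.2 u)) ω

lemma sum_mul_eq_one {ν ν' : (V → Bool) → ℝ} (hν : IsProbDist ν) (hν' : IsProbDist ν') :
    ∑ p : (V → Bool) × (V → Bool), ν p.1 * ν' p.2 = 1 := by
  rw [← Finset.univ_product_univ, Finset.sum_product]
  simp only [← Finset.mul_sum, hν.2, hν'.2, mul_one]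

lemma isProbDist_xorConv {ν ν' : (V → Bool) → ℝ} (hν : IsProbDist ν) (hν' : IsProbDist ν') :
    IsProbDist (xorConv ν ν') :=
  isProbDist_mixture (fun p => mul_nonneg (hν.1 p.1) (hν'.1 p.2)) (sum_mul_eq_one hν hν')
    fun _ => isProbDist_pointMass _

lemma pr_xorConv (ν ν' : (V → Bool) → ℝ) (P : (V → Bool) → Prop) :
    Pr (xorConv ν ν') P =
      ∑ a, ∑ b, ν a * ν' b * if P (fun u => xor (a u) (b u)) then 1 else 0 := by
  unfold xorConv
  rw [pr_mixture (fun p : (V → Bool) × (V → Bool) => ν p.1 * ν' p.2)]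
  simp only [pr_pointMass]
  rw [← Finset.univ_product_univ, Finset.sum_product]

lemma pr_eq_sum_mul (ν : (V → Bool) → ℝ) (P : (V → Bool) → Prop) :
    Pr ν P = ∑ a, ν a * if P a then 1 else 0 := by
  simp [Pr]

lemma one_sub_two_pr_xorConv {ν ν' : (V → Bool) → ℝ} (hν : IsProbDist ν) (hν' : IsProbDist ν')
    (u v : V) : 1 - 2 * Pr (xorConv ν ν') (fun ω => ω u ≠ ω v) =
      (1 - 2 * Pr ν (fun ω => ω u ≠ ω v)) * (1 - 2 * Pr ν' (fun ω => ω u ≠ ω v)) := by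
  have hbias : ∀ {ν : (V → Bool) → ℝ}, IsProbDist ν → 1 - 2 * Pr ν (fun ω => ω u ≠ ω v) =
      ∑ a, ν a * (1 - 2 * if a u ≠ a v then 1 else 0) := by
    intro ν hν
    rw [pr_eq_sum_mul]
    simp only [mul_sub, Finset.sum_sub_distrib, mul_one, hν.2, Finset.mul_sum]
    congr 1
    exact Finset.sum_congr rfl fun a _ => by split_ifs <;> ring
  rw [hbias hν, hbias hν', Finset.sum_mul_sum, pr_xorConv]
  have h1 := sum_mul_eq_one hν hν'
  rw [← Finset.univ_product_univ, Finset.sum_product] at h1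
  nth_rewrite 1 [← h1]
  simp only [Finset.mul_sum, ← Finset.sum_sub_distrib]
  refine Finset.sum_congr rfl fun a _ => Finset.sum_congr rfl fun b _ => ?_
  have : (1 - 2 * if xor (a u) (b u) ≠ xor (a v) (b v) then (1 : ℝ) else 0) =
      (1 - 2 * if a u ≠ a v then 1 else 0) * (1 - 2 * if b u ≠ b v then 1 else 0) := by
    cases a u <;> cases a v <;> cases b u <;> cases b v <;> norm_num
  split_ifs at this ⊢ <;> linear_combination (ν a * ν' b) * this

lemma pr_xorConv_cut_le {ν ν' : (V → Bool) → ℝ} (hν : IsProbDist ν) (hν' : IsProbDist ν')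
    (e : Finset V) : Pr (xorConv ν ν') (fun ω => ∃ u ∈ e, ∃ v ∈ e, ω u ≠ ω v) ≤
      Pr ν (fun ω => ∃ u ∈ e, ∃ v ∈ e, ω u ≠ ω v) +
        Pr ν' (fun ω => ∃ u ∈ e, ∃ v ∈ e, ω u ≠ ω v) := by
  set Q : (V → Bool) → Prop := fun ω => ∃ u ∈ e, ∃ v ∈ e, ω u ≠ ω v
  have hQ : ∀ a b : V → Bool, Q (fun u => xor (a u) (b u)) → Q a ∨ Q b := by
    rintro a b ⟨u, hu, v, hv, h⟩
    by_cases h1 : a u = a v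
    · refine Or.inr ⟨u, hu, v, hv, fun h2 => h ?_⟩
      simp only [h1, h2]
    · exact Or.inl ⟨u, hu, v, hv, h1⟩
  have e1 : Pr ν Q = ∑ a, ∑ b, ν a * ν' b * if Q a then 1 else 0 := by
    rw [pr_eq_sum_mul]
    refine Finset.sum_congr rfl fun a _ => ?_
    rw [← Finset.sum_mul, ← Finset.mul_sum, hν'.2, mul_one]
    congr
  have e2 : Pr ν' Q = ∑ a, ∑ b, ν a * ν' b * if Q b then 1 else 0 := by
    rw [pr_eq_sum_mul]
    simp only [mul_assoc, ← Finset.mul_sum]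
    rw [← Finset.sum_mul, hν.2, one_mul]
    refine Finset.sum_congr rfl fun a _ => ?_
    congr
  rw [pr_xorConv, e1, e2, ← Finset.sum_add_distrib]
  refine Finset.sum_le_sum fun a _ => ?_
  rw [← Finset.sum_add_distrib]
  refine Finset.sum_le_sum fun b _ => ?_
  rw [← mul_add]
  refine mul_le_mul_of_nonneg_left ?_ (mul_nonneg (hν.1 a) (hν'.1 b))
  by_cases h : Q fun u => xor (a u) (b u)
  · rw [if_pos h]
    rcases hQ a b h with h' | h'
    · rw [if_pos h']
      split_ifs <;> norm_num
    · rw [if_pos h']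
      split_ifs <;> norm_num
  · rw [if_neg h]
    split_ifs <;> norm_num

lemma exists_xor_power {ν : (V → Bool) → ℝ} (hν : IsProbDist ν) (k : ℕ) :
    ∃ ν' : (V → Bool) → ℝ, IsProbDist ν' ∧
      (∀ u v, 1 - 2 * Pr ν' (fun ω => ω u ≠ ω v) = (1 - 2 * Pr ν (fun ω => ω u ≠ ω v)) ^ k) ∧
      ∀ e : Finset V, Pr ν' (fun ω => ∃ u ∈ e, ∃ v ∈ e, ω u ≠ ω v) ≤
        k * Pr ν (fun ω => ∃ u ∈ e, ∃ v ∈ e, ω u ≠ ω v) := by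
  induction k with
  | zero =>
    refine ⟨pointMass fun _ => false, isProbDist_pointMass _, ?_, ?_⟩ <;> simp [pr_pointMass]
  | succ k ih =>
    obtain ⟨ν', h0, h1, h2⟩ := ih
    refine ⟨xorConv ν' ν, isProbDist_xorConv h0 hν, fun u v => ?_, fun e => ?_⟩
    · rw [one_sub_two_pr_xorConv h0 hν, h1, pow_succ]
    · refine (pr_xorConv_cut_le h0 hν e).trans ?_
      push_cast
      linarith [h2 e]

/-- Mixing with a constant assignment makes all disagreement probabilities at most `1 / 2`. -/
lemma exists_lazy {ν : (V → Bool) → ℝ} (hν : IsProbDist ν) :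
    ∃ ν' : (V → Bool) → ℝ, IsProbDist ν' ∧
      (∀ u v, Pr ν' (fun ω => ω u ≠ ω v) = Pr ν (fun ω => ω u ≠ ω v) / 2) ∧
      ∀ e : Finset V, Pr ν' (fun ω => ∃ u ∈ e, ∃ v ∈ e, ω u ≠ ω v) =
        Pr ν (fun ω => ∃ u ∈ e, ∃ v ∈ e, ω u ≠ ω v) / 2 := by
  refine ⟨fun ω => ∑ i : Bool, (1 / 2) * (if i then ν else pointMass fun _ => false) ω,
    isProbDist_mixture (fun _ => by norm_num) (by simp) ?_, fun u v => ?_, fun e => ?_⟩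
  · intro i
    cases i
    · simpa using isProbDist_pointMass _
    · simpa using hν
  all_goals
    rw [pr_mixture (fun _ => 1 / 2) fun i : Bool => if i then ν else pointMass fun _ => false]
    simp [pr_pointMass]
    ring

end Distributions

/-- Every `ℓ₂²` metric has a random two-colouring separating all pairs at distance at least `1` with
constant probability and cutting small sets rarely. -/
lemma exists_base_probDist {V : Type*} [Fintype V] [DecidableEq V] {N : ℕ} {y : V → Fin N → ℝ}
    (htri : ∀ u v w, sqd y u w ≤ sqd y u v + sqd y v w) {L : ℝ} (hL1 : 1 ≤ L)
    (hL : Real.log (Fintype.card V) < L) :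
    ∃ ν : (V → Bool) → ℝ, IsProbDist ν ∧
      (∀ u v, 1 ≤ sqd y u v → 1 / 192 ≤ Pr ν (fun ω => ω u ≠ ω v)) ∧
      ∀ (e : Finset V) (D : ℝ), 0 ≤ D → (∀ u ∈ e, ∀ v ∈ e, sqd y u v ≤ D) →
        Pr ν (fun ω => ∃ u ∈ e, ∃ v ∈ e, ω u ≠ ω v) ≤ D / sepScale L := by
  have hΔ : 0 < sepScale L := by
    have : 0 < √L := Real.sqrt_pos.2 (by linarith)
    unfold sepScale
    positivity
  have hA : ∀ A : Finset V, ∃ ν : (V → Bool) → ℝ, IsProbDist ν ∧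
      (∀ u v, u ∈ A → (∀ a ∈ A, sepScale L ≤ sqd y a v) → Pr ν (fun ω => ω u ≠ ω v) = 1) ∧
      ∀ (e : Finset V) (D : ℝ), 0 ≤ D → (∀ u ∈ e, ∀ v ∈ e, sqd y u v ≤ D) →
        Pr ν (fun ω => ∃ u ∈ e, ∃ v ∈ e, ω u ≠ ω v) ≤ D / sepScale L := by
    intro A
    rcases A.eq_empty_or_nonempty with rfl | hne
    · refine ⟨pointMass fun _ => false, isProbDist_pointMass _, by simp, fun e D hD _ => ?_⟩
      rw [pr_pointMass]
      simpa using div_nonneg hD hΔ.le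
    · obtain ⟨ν, h0, h1, h2⟩ := exists_threshold_probDist
        (fun u => A.inf' hne fun a => sqd y a u) hΔ
      refine ⟨ν, h0, fun u v hu hv => h1 u v ?_ (Finset.le_inf' _ _ hv),
        fun e D hD0 hD => h2 e D hD0 fun u hu v hv => ?_⟩
      · exact (Finset.inf'_le _ hu).trans (sqd_self y u).le
      · obtain ⟨a, ha, hau⟩ := Finset.exists_mem_eq_inf' hne fun a => sqd y a u
        rw [hau]
        have h3 : A.inf' hne (fun a => sqd y a v) ≤ sqd y a v := Finset.inf'_le _ ha
        linarith [htri a u v, hD u hu v hv]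
  choose νA h0 h1 h2 using hA
  obtain ⟨l, hl0, hl1, hl⟩ := exists_mixed_strategy (A := Finset V)
    (P := {p : V × V // 1 ≤ sqd y p.1 p.2})
    (fun A p => if p.1.1 ∈ A ∧ ∀ a ∈ A, sepScale L ≤ sqd y a p.1.2 then 1 else 0) (1 / 192) (by
      intro w hw0 hw1
      set w' : V → V → ℝ := fun u v => if h : 1 ≤ sqd y u v then w ⟨(u, v), h⟩ else 0 with hw'
      have hsum : ∀ F : V → V → ℝ, ∑ u, ∑ v, w' u v * F u v = ∑ p, w p * F p.1.1 p.1.2 := by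
        intro F
        have h3 : ∀ p : V × V, ¬1 ≤ sqd y p.1 p.2 → w' p.1 p.2 * F p.1 p.2 = 0 := by
          intro p hp
          simp [hw', hp]
        have h4 : ∑ u, ∑ v, w' u v * F u v = ∑ p : V × V, w' p.1 p.2 * F p.1 p.2 := by
          rw [← Finset.univ_product_univ, Finset.sum_product]
        rw [h4, ← Finset.sum_subset (Finset.subset_univ
          (Finset.univ.filter fun p : V × V => 1 ≤ sqd y p.1 p.2)) fun p _ hp =>
            h3 p (by simpa using hp),
          Finset.sum_subtype (p := fun p : V × V => 1 ≤ sqd y p.1 p.2) _ (fun p => by simp)]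
        refine Finset.sum_congr rfl fun p _ => ?_
        simp [hw', p.2]
      obtain ⟨A, hA⟩ := exists_separating_set htri hL1 hL w' (fun u v => by
        simp only [hw']
        split_ifs
        · exact hw0 _
        · exact le_rfl) (by simpa [hw1] using hsum fun _ _ => 1) (fun u v h => by
        by_contra hn
        exact h (by simp [hw', hn]))
      exact ⟨A, hA.trans (hsum fun u v =>
        if u ∈ A ∧ ∀ a ∈ A, sepScale L ≤ sqd y a v then 1 else 0).le⟩)
  refine ⟨fun ω => ∑ A, l A * νA A ω, isProbDist_mixture hl0 hl1 h0, fun u v huv => ?_,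
    fun e D hD0 hD => ?_⟩
  · rw [pr_mixture]
    refine (hl ⟨(u, v), huv⟩).trans (Finset.sum_le_sum fun A _ =>
      mul_le_mul_of_nonneg_left ?_ (hl0 A))
    split_ifs with h
    · exact (h1 A u v h.1 h.2).ge
    · exact pr_nonneg (h0 A) _
  · rw [pr_mixture]
    calc _ ≤ ∑ A, l A * (D / sepScale L) := Finset.sum_le_sum fun A _ =>
          mul_le_mul_of_nonneg_left (h2 A e D hD0 hD) (hl0 A)
      _ = _ := by rw [← Finset.sum_mul, hl1, one_mul]

lemma exists_sqd_eq {V H : Type*} [Fintype V] [NormedAddCommGroup H] [InnerProductSpace ℝ H]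
    (x : V → H) {β : ℝ} (hβ : 0 < β) :
    ∃ (N : ℕ) (y : V → Fin N → ℝ), ∀ u v, sqd y u v = ‖x u - x v‖ ^ 2 / β := by
  have : FiniteDimensional ℝ (Submodule.span ℝ (Set.range x)) :=
    FiniteDimensional.span_of_finite ℝ (Set.finite_range x)
  set b := stdOrthonormalBasis ℝ (Submodule.span ℝ (Set.range x))
  set z : V → Submodule.span ℝ (Set.range x) :=
    fun u => ⟨x u, Submodule.subset_span (Set.mem_range_self u)⟩ with hz
  refine ⟨_, fun u k => b.repr (z u) k / √β, fun u v => ?_⟩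
  have h1 : ‖x u - x v‖ ^ 2 = ∑ k, (b.repr (z u) k - b.repr (z v) k) ^ 2 := by
    have h2 : ‖x u - x v‖ = ‖b.repr (z u - z v)‖ := by
      rw [LinearIsometryEquiv.norm_map]
      rfl
    rw [h2, EuclideanSpace.real_norm_sq_eq]
    simp
  rw [h1, sqd, Finset.sum_div]
  refine Finset.sum_congr rfl fun k _ => ?_
  rw [← sub_div, div_pow, Real.sq_sqrt hβ.le]

lemma le_maxDistSq {V H : Type*} [NormedAddCommGroup H] (x : V → H) {e : Finset V} {u v : V}
    (hu : u ∈ e) (hv : v ∈ e) : ‖x u - x v‖ ^ 2 ≤ maxDistSq x e := by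
  refine le_csSup ?_ ⟨u, hu, v, hv, rfl⟩
  refine ((e ×ˢ e).image fun p => ‖x p.1 - x p.2‖ ^ 2).bddAbove.mono ?_
  rintro _ ⟨a, ha, b, hb, rfl⟩
  simp only [Finset.coe_image, Set.mem_image, Finset.mem_coe, Finset.mem_product]
  exact ⟨(a, b), ⟨ha, hb⟩, rfl⟩

/-- Amplifying a bias of `1 / 192` to `1 / ℓ` takes `O(log ℓ)` rounds. -/
lemma exists_amplification_length {ℓ : ℝ} (hℓ : 2 ≤ ℓ) :
    ∃ k : ℕ, (1 - 1 / 192 : ℝ) ^ k ≤ 1 / ℓ ∧ (k : ℝ) ≤ 193 * Real.logb 2 ℓ := by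
  have hlog2 : Real.log 2 < 1 := by linarith [Real.log_two_lt_d9]
  have hlogb : Real.log ℓ ≤ Real.logb 2 ℓ := by
    rw [Real.logb, le_div_iff₀ (Real.log_pos one_lt_two)]
    nlinarith [Real.log_nonneg (show (1 : ℝ) ≤ ℓ by linarith)]
  have hone : 1 ≤ Real.logb 2 ℓ := by
    rwa [Real.le_logb_iff_rpow_le one_lt_two (by linarith), Real.rpow_one]
  refine ⟨⌈192 * Real.log ℓ⌉₊, ?_, ?_⟩
  · have h1 : (1 - 1 / 192 : ℝ) ≤ Real.exp (-(1 / 192)) := by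
      linarith [Real.add_one_le_exp (-(1 / 192))]
    refine (pow_le_pow_left₀ (by norm_num) h1 _).trans ?_
    rw [← Real.exp_nat_mul, one_div ℓ, ← Real.exp_log (show 0 < ℓ by linarith), ← Real.exp_neg,
      Real.exp_le_exp, Real.log_exp]
    linarith [Nat.le_ceil (192 * Real.log ℓ)]
  · have := Nat.ceil_lt_add_one (show 0 ≤ 192 * Real.log ℓ by
      have := Real.log_nonneg (show (1 : ℝ) ≤ ℓ by linarith)
      positivity)
    linarith

theorem stmt_3 : ∃ C : ℝ, 0 < C ∧
    ∀ (V : Type) [Fintype V] [DecidableEq V]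
      (H : Type) [NormedAddCommGroup H] [InnerProductSpace ℝ H]
      (x : V → H) (β m : ℝ),
      2 ≤ Fintype.card V → (∀ u, ‖x u‖ = 1) →
      (∀ u v w : V, ‖x u - x w‖ ^ 2 ≤ ‖x u - x v‖ ^ 2 + ‖x v - x w‖ ^ 2) →
      0 < β → β < 1 → 4 ≤ m →
      ∃ ν : (V → Bool) → ℝ, IsProbDist ν ∧
        (∀ u v : V, β ≤ ‖x u - x v‖ ^ 2 →
          1 / 2 - 1 / Real.logb 2 m ≤ Pr ν (fun ω => ω u ≠ ω v)) ∧
        (∀ e : Finset V, 2 ≤ e.card →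
          Pr ν (fun ω => ∃ u ∈ e, ∃ v ∈ e, ω u ≠ ω v) ≤
            C * β⁻¹ * Real.sqrt (Real.logb 2 (Fintype.card V)) *
              Real.logb 2 (Real.logb 2 m) * maxDistSq x e) := by
  refine ⟨193 * (16 * 192 ^ 2) / 2, by norm_num, ?_⟩
  intro V _ _ H _ _ x β m hV _ htri hβ _ hm
  obtain ⟨N, y, hy⟩ := exists_sqd_eq x hβ
  have hV' : (2 : ℝ) ≤ Fintype.card V := by exact_mod_cast hV
  set L := Real.logb 2 (Fintype.card V) with hLdef
  have hL1 : 1 ≤ L := by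
    rwa [hLdef, Real.le_logb_iff_rpow_le one_lt_two (by linarith), Real.rpow_one]
  have hL : Real.log (Fintype.card V) < L := by
    rw [hLdef, Real.logb, lt_div_iff₀ (Real.log_pos one_lt_two)]
    nlinarith [Real.log_pos (show (1 : ℝ) < Fintype.card V by linarith), Real.log_two_lt_d9]
  have hℓ : 2 ≤ Real.logb 2 m := by
    rw [Real.le_logb_iff_rpow_le one_lt_two (by linarith)]
    norm_num [hm]
  obtain ⟨ν₀, h0, hsep₀, hcut₀⟩ := exists_base_probDist (y := y) (fun u v w => by
    rw [hy, hy, hy, ← add_div]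
    exact div_le_div_of_nonneg_right (htri u v w) hβ.le) hL1 hL
  obtain ⟨ν₁, h1, hsep₁, hcut₁⟩ := exists_lazy h0
  obtain ⟨k, hk, hkle⟩ := exists_amplification_length hℓ
  obtain ⟨ν, h2, hsep, hcut⟩ := exists_xor_power h1 k
  refine ⟨ν, h2, fun u v huv => ?_, fun e he => ?_⟩
  · have h3 := hsep₀ u v (by rwa [hy, one_le_div hβ])
    have h4 := pr_le_one h0 fun ω => ω u ≠ ω v
    have h5 := hsep u v
    rw [hsep₁] at h5
    have h6 : (1 - 2 * (Pr ν₀ (fun ω => ω u ≠ ω v) / 2)) ^ k ≤ (1 - 1 / 192 : ℝ) ^ k :=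
      pow_le_pow_left₀ (by linarith) (by linarith) k
    have h7 : 0 < 1 / Real.logb 2 m := by positivity
    linarith
  · have hne : e.Nonempty := Finset.card_pos.1 (by omega)
    obtain ⟨a, ha⟩ := hne
    have hD : 0 ≤ maxDistSq x e := (sq_nonneg _).trans (le_maxDistSq x ha ha)
    have h3 := hcut₀ e (maxDistSq x e / β) (by positivity) fun u hu v hv => by
      rw [hy]
      exact div_le_div_of_nonneg_right (le_maxDistSq x hu hv) hβ.le
    have hscale : maxDistSq x e / β / sepScale L =
        16 * 192 ^ 2 * (β⁻¹ * √L * maxDistSq x e) := by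
      have : 0 < √L := Real.sqrt_pos.2 (by linarith)
      unfold sepScale
      field_simp
      norm_num
      ring
    rw [hscale] at h3
    calc _ ≤ k * (Pr ν₀ (fun ω => ∃ u ∈ e, ∃ v ∈ e, ω u ≠ ω v) / 2) := by
          rw [← hcut₁]
          exact hcut e
      _ ≤ 193 * Real.logb 2 (Real.logb 2 m) *
          (16 * 192 ^ 2 * (β⁻¹ * √L * maxDistSq x e) / 2) := by
          refine mul_le_mul hkle (by linarith) ?_ ((Nat.cast_nonneg k).trans hkle)
          linarith [pr_nonneg h0 fun ω => ∃ u ∈ e, ∃ v ∈ e, ω u ≠ ω v]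
      _ = _ := by ring

end
end

section
/- There exists an absolute constant C > 0 such that the following holds. For every finite set V, every family of unit vectors (x_u)_{u∈V} in a finite-dimensional real inner product space satisfying ‖x_u − x_v‖² + ‖x_v − x_w‖² ≥ ‖x_u − x_w‖² for all u,v,w ∈ V, and every β ∈ (0,1), there exists a random assignment ω : V → {0,1} such that: (i) for every set e ⊆ V with |e| ≥ 2, Pr(ω(u) ≠ ω(v) for some u,v ∈ e) ≤ C·β^{-1/2}·√(log₂ |e|)·max_{u,v∈e} ‖x_u − x_v‖; and (ii) for every u,v ∈ V with ‖x_u − x_v‖² ≥ β, Pr(ω(u) ≠ ω(v)) ≥ 0.3. -/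
open scoped Classical BigOperators RealInnerProductSpace

noncomputable section

section RandomParity

open MeasureTheory ProbabilityTheory Set

theorem one_sub_cos_le_self {θ : ℝ} (hθ : 0 ≤ θ) : 1 - Real.cos θ ≤ θ := by
  rcases le_total θ 2 with h | h
  · nlinarith [Real.one_sub_sq_div_two_le_cos (x := θ)]
  · linarith [Real.neg_one_le_cos θ]

/-- The floors of `a + t` and `b + t` agree for all `t ∈ [0, 1)` outside a set of measure
at most `b - a`. -/
theorem volume_floor_add_ne_le {a b : ℝ} (hab : a ≤ b) :
    volume ({t : ℝ | ⌊a + t⌋ ≠ ⌊b + t⌋} ∩ Ico 0 1) ≤ ENNReal.ofReal (b - a) := by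
  rcases le_or_gt 1 (b - a) with h1 | h1
  · calc volume ({t : ℝ | ⌊a + t⌋ ≠ ⌊b + t⌋} ∩ Ico 0 1) ≤ volume (Ico (0 : ℝ) 1) :=
          measure_mono inter_subset_right
      _ ≤ ENNReal.ofReal (b - a) := by
          rw [Real.volume_Ico]
          exact ENNReal.ofReal_le_ofReal (by linarith)
  have ha := Int.floor_le a
  have ha' := Int.lt_floor_add_one a
  have hb := Int.floor_le b
  have hb' := Int.lt_floor_add_one b
  have hnm : ⌊a⌋ ≤ ⌊b⌋ := Int.floor_mono hab
  have hmn : ⌊b⌋ < ⌊a⌋ + 2 := by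
    have : (⌊b⌋ : ℝ) < ⌊a⌋ + 2 := by linarith
    exact_mod_cast this
  have floor_eq : ∀ (n : ℤ) (t : ℝ), n ≤ a + t → a + t < n + 1 → n ≤ b + t → b + t < n + 1 →
      ⌊a + t⌋ = ⌊b + t⌋ := fun n t h1 h2 h3 h4 =>
    (Int.floor_eq_iff.2 ⟨h1, h2⟩).trans (Int.floor_eq_iff.2 ⟨h3, h4⟩).symm
  rcases (by omega : ⌊b⌋ = ⌊a⌋ ∨ ⌊b⌋ = ⌊a⌋ + 1) with h | h
  · have hsub : {t : ℝ | ⌊a + t⌋ ≠ ⌊b + t⌋} ∩ Ico 0 1 ⊆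
        Ico (⌊a⌋ + 1 - b) (⌊a⌋ + 1 - a) := by
      rintro t ⟨hne, ht0, ht1⟩
      rw [h] at hb hb'
      by_contra hcon
      apply hne
      rw [mem_Ico, not_and_or, not_le, not_lt] at hcon
      rcases hcon with hc | hc
      · exact floor_eq ⌊a⌋ t (by linarith) (by linarith) (by linarith) (by linarith)
      · exact floor_eq (⌊a⌋ + 1) t (by push_cast; linarith) (by push_cast; linarith)
          (by push_cast; linarith) (by push_cast; linarith)
    refine (measure_mono hsub).trans ?_
    rw [Real.volume_Ico]
    exact ENNReal.ofReal_le_ofReal (by linarith)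
  · have hsub : {t : ℝ | ⌊a + t⌋ ≠ ⌊b + t⌋} ∩ Ico 0 1 ⊆
        Ico 0 (⌊a⌋ + 1 - a) ∪ Ico (⌊a⌋ + 2 - b) 1 := by
      rintro t ⟨hne, ht0, ht1⟩
      rw [h] at hb hb'
      push_cast at hb hb'
      by_contra hcon
      apply hne
      rw [mem_union, not_or, mem_Ico, mem_Ico, not_and, not_and'] at hcon
      have h3 := hcon.1 ht0
      have h4 := hcon.2 ht1
      exact floor_eq (⌊a⌋ + 1) t (by push_cast; linarith) (by push_cast; linarith)
        (by push_cast; linarith) (by push_cast; linarith)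
    refine (measure_mono hsub).trans ((measure_union_le _ _).trans ?_)
    rw [h] at hb hb'
    push_cast at hb hb'
    rw [Real.volume_Ico, Real.volume_Ico, ← ENNReal.ofReal_add (by linarith) (by linarith)]
    exact ENNReal.ofReal_le_ofReal (by linarith)

/-- For `t` uniform in `[0, 1)`, the floors of `a + t` and `b + t` have different parities with
probability at least `(1 - cos (π (a - b))) / π`. -/
theorem le_volume_floor_add_parity_ne (a b : ℝ) :
    ENNReal.ofReal ((1 - Real.cos (Real.pi * (a - b))) / Real.pi) ≤
      volume ({t : ℝ | ¬(Even ⌊a + t⌋ ↔ Even ⌊b + t⌋)} ∩ Ico 0 1) := by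
  wlog hfg : Int.fract a ≤ Int.fract b generalizing a b
  · have := this b a (le_of_not_ge hfg)
    rw [← neg_sub a b, mul_neg, Real.cos_neg] at this
    simpa only [iff_comm] using this
  have hf := Int.fract_nonneg a
  have hg := Int.fract_lt_one b
  have hfa := Int.floor_add_fract a
  have hgb := Int.floor_add_fract b
  have hpi := Real.pi_pos
  have bound : ∀ s : ℝ, 0 ≤ s → (1 - Real.cos (Real.pi * s)) / Real.pi ≤ s := fun s hs => by
    rw [div_le_iff₀ hpi, mul_comm s]
    exact one_sub_cos_le_self (by positivity)
  set f := Int.fract a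
  set g := Int.fract b
  have flo : ∀ (n : ℤ) (c r t : ℝ), n + r = c → 0 ≤ r + t → r + t < 1 → ⌊c + t⌋ = n := by
    intro n c r t h1 h2 h3
    rw [Int.floor_eq_iff]
    constructor <;> linarith
  have flo1 : ∀ (n : ℤ) (c r t : ℝ), n + r = c → 1 ≤ r + t → r + t < 2 → ⌊c + t⌋ = n + 1 := by
    intro n c r t h1 h2 h3
    rw [Int.floor_eq_iff]
    push_cast
    constructor <;> linarith
  have hab : a - b = (f - g) + (⌊a⌋ - ⌊b⌋ : ℤ) := by push_cast; linarith
  by_cases hpar : Even ⌊a⌋ ↔ Even ⌊b⌋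
  · have hcos : Real.cos (Real.pi * (a - b)) = Real.cos (Real.pi * (g - f)) := by
      obtain ⟨k, hk⟩ := Int.even_sub.2 hpar
      rw [hab, hk, ← Real.cos_neg (Real.pi * (g - f)),
        ← Real.cos_add_int_mul_two_pi (-(Real.pi * (g - f))) k]
      congr 1
      push_cast
      ring
    have hsub : Ico (1 - g) (1 - f) ⊆
        {t : ℝ | ¬(Even ⌊a + t⌋ ↔ Even ⌊b + t⌋)} ∩ Ico 0 1 := by
      rintro t ⟨h1, h2⟩
      refine ⟨?_, by linarith, by linarith⟩
      rw [mem_ofPred_eq, flo ⌊a⌋ a f t hfa (by linarith) (by linarith),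
        flo1 ⌊b⌋ b g t hgb (by linarith) (by linarith), Int.even_add_one]
      tauto
    refine le_trans ?_ (measure_mono hsub)
    rw [Real.volume_Ico, hcos]
    refine ENNReal.ofReal_le_ofReal ((bound (g - f) (by linarith)).trans (by linarith))
  · have hcos : Real.cos (Real.pi * (a - b)) = Real.cos (Real.pi * (1 - (g - f))) := by
      obtain ⟨k, hk⟩ : Odd (⌊a⌋ - ⌊b⌋) := by
        rw [← Int.not_even_iff_odd, Int.even_sub]
        exact hpar
      rw [hab, hk, ← Real.cos_add_int_mul_two_pi (Real.pi * (1 - (g - f))) k]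
      congr 1
      push_cast
      ring
    have hsub : Ico 0 (1 - g) ∪ Ico (1 - f) 1 ⊆
        {t : ℝ | ¬(Even ⌊a + t⌋ ↔ Even ⌊b + t⌋)} ∩ Ico 0 1 := by
      rintro t (⟨h1, h2⟩ | ⟨h1, h2⟩)
      · refine ⟨?_, by linarith, by linarith⟩
        rw [mem_ofPred_eq, flo ⌊a⌋ a f t hfa (by linarith) (by linarith),
          flo ⌊b⌋ b g t hgb (by linarith) (by linarith)]
        exact hpar
      · refine ⟨?_, by linarith, by linarith⟩
        rw [mem_ofPred_eq, flo1 ⌊a⌋ a f t hfa (by linarith) (by linarith),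
          flo1 ⌊b⌋ b g t hgb (by linarith) (by linarith), Int.even_add_one, Int.even_add_one]
        tauto
    refine le_trans ?_ (measure_mono hsub)
    have hdisj : Disjoint (Ico 0 (1 - g)) (Ico (1 - f) 1) := by
      rw [Set.disjoint_left]
      rintro t ⟨_, h1⟩ ⟨h2, _⟩
      linarith
    rw [measure_union hdisj measurableSet_Ico, Real.volume_Ico, Real.volume_Ico,
      ← ENNReal.ofReal_add (by linarith) (by linarith), hcos]
    exact ENNReal.ofReal_le_ofReal ((bound (1 - (g - f)) (by linarith)).trans (by linarith))

theorem norm_sub_le_maxDist {V H : Type*} [NormedAddCommGroup H] (x : V → H) (e : Finset V)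
    {u v : V} (hu : u ∈ e) (hv : v ∈ e) : ‖x u - x v‖ ≤ maxDist x e := by
  refine le_csSup ?_ ⟨u, hu, v, hv, rfl⟩
  refine ((e ×ˢ e).image fun p => ‖x p.1 - x p.2‖).bddAbove.mono ?_
  rintro _ ⟨a, ha, b, hb, rfl⟩
  rw [Finset.mem_coe, Finset.mem_image]
  exact ⟨(a, b), Finset.mk_mem_product ha hb, rfl⟩

theorem Pr_map_eq {Ω S : Type*} [Fintype Ω] [MeasurableSpace Ω] [MeasurableSingletonClass Ω]
    [MeasurableSpace S] (μ : Measure S) [IsFiniteMeasure μ] {F : S → Ω} (hF : Measurable F)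
    (P : Ω → Prop) : Pr (fun ω => μ.real {s | F s = ω}) P = μ.real {s | P (F s)} := by
  have hset : {s | P (F s)} = ⋃ ω ∈ Finset.univ.filter P, {s | F s = ω} := by
    ext s
    simp
  rw [Pr, ← Finset.sum_filter, hset, measureReal_biUnion_finset]
  · intro a _ b _ hab
    exact Set.disjoint_left.2 fun s hs hs' => hab (hs.symm.trans hs')
  · exact fun ω _ => hF (measurableSet_singleton ω)

section Gaussian

variable {H : Type*} [NormedAddCommGroup H] [InnerProductSpace ℝ H] [FiniteDimensional ℝ H]
  [MeasurableSpace H] [BorelSpace H]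

theorem map_inner_stdGaussian (z : H) :
    (stdGaussian H).map (fun y => ⟪y, z⟫) = gaussianReal 0 (‖z‖₊ ^ 2) := by
  have hm : AEMeasurable (fun y : H => ⟪y, z⟫) (stdGaussian H) := by fun_prop
  have : IsProbabilityMeasure ((stdGaussian H).map (fun y => ⟪y, z⟫)) :=
    Measure.isProbabilityMeasure_map hm
  apply Measure.ext_of_charFun
  ext t
  rw [charFun_apply_real, integral_map hm (by fun_prop), charFun_gaussianReal]
  have := charFun_stdGaussian (t • z)
  rw [charFun_apply] at this
  simp only [inner_smul_right] at this
  push_cast at this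
  rw [this, norm_smul]
  congr 1
  simp only [Complex.ofReal_mul, mul_pow, ← Complex.ofReal_pow, Real.norm_eq_abs, sq_abs]
  push_cast
  ring

theorem integral_exp_inner_stdGaussian (z : H) :
    ∫ y, Real.exp ⟪y, z⟫ ∂(stdGaussian H) = Real.exp (‖z‖ ^ 2 / 2) := by
  have := mgf_gaussianReal (map_inner_stdGaussian z) 1
  simpa [mgf] using this

theorem integrable_exp_inner_stdGaussian (z : H) :
    Integrable (fun y => Real.exp ⟪y, z⟫) (stdGaussian H) := by
  by_contra h
  have := integral_exp_inner_stdGaussian z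
  rw [integral_undef h] at this
  exact (Real.exp_pos _).ne this

theorem integral_cos_inner_stdGaussian (z : H) :
    ∫ y, Real.cos ⟪y, z⟫ ∂(stdGaussian H) = Real.exp (-(‖z‖ ^ 2 / 2)) := by
  have := congrArg Complex.re (charFun_stdGaussian z)
  rw [charFun_apply] at this
  have hint : Integrable (fun y : H => Complex.exp (⟪y, z⟫ * Complex.I)) (stdGaussian H) := by
    refine Integrable.of_bound (by fun_prop) 1 (.of_forall fun y => ?_)
    rw [Complex.norm_exp_ofReal_mul_I]
  have hre := integral_re hint
  simp only [RCLike.re_eq_complex_re, Complex.exp_ofReal_mul_I_re] at hre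
  rw [hre, this, ← Complex.exp_ofReal_re]
  congr 2
  push_cast
  ring

/-- The probability space behind the random assignment: a standard Gaussian direction and an
independent uniform shift in `[0, 1)`. -/
def gaussianShift (H : Type*) [NormedAddCommGroup H] [InnerProductSpace ℝ H]
    [FiniteDimensional ℝ H] [MeasurableSpace H] [BorelSpace H] : Measure (H × ℝ) :=
  (stdGaussian H).prod (volume.restrict (Ico (0 : ℝ) 1))

instance : IsProbabilityMeasure (volume.restrict (Ico (0 : ℝ) 1)) := ⟨by simp⟩

instance : IsProbabilityMeasure (gaussianShift H) := by
  unfold gaussianShift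
  infer_instance

/-- Project onto the direction `p.1`, rescale, shift by `p.2`, and label by the parity of the
integer part. -/
def parityAssignment {V : Type*} (x : V → H) (w : ℝ) (p : H × ℝ) (u : V) : Bool :=
  decide (Even ⌊⟪p.1, w • x u⟫ + p.2⌋)

theorem measurable_parityAssignment {V : Type*} (x : V → H) (w : ℝ) :
    Measurable (parityAssignment x w) := by
  refine measurable_pi_lambda _ fun u => ?_
  have h : Measurable (fun n : ℤ => (decide (Even n) : Bool)) := measurable_from_top
  exact h.comp (Int.measurable_floor.comp (by fun_prop))

theorem gaussianShift_parityAssignment_apply {V : Type*} [Finite V] (x : V → H) (w : ℝ)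
    (P : (V → Bool) → Prop) :
    gaussianShift H {p | P (parityAssignment x w p)} =
      ∫⁻ y, volume ({t | P (parityAssignment x w (y, t))} ∩ Ico 0 1) ∂(stdGaussian H) := by
  have hS : MeasurableSet {p | P (parityAssignment x w p)} :=
    measurable_parityAssignment x w (MeasurableSet.of_discrete (s := {ω | P ω}))
  rw [gaussianShift, Measure.prod_apply hS]
  refine lintegral_congr fun y => ?_
  rw [Measure.restrict_apply (measurable_prodMk_left hS)]
  rfl

theorem le_gaussianShift_parityAssignment_ne {V : Type*} [Finite V] (x : V → H) (w : ℝ) (u v : V) :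
    (1 - Real.exp (-(Real.pi ^ 2 * w ^ 2 * ‖x u - x v‖ ^ 2 / 2))) / Real.pi ≤
      (gaussianShift H).real {p | parityAssignment x w p u ≠ parityAssignment x w p v} := by
  have hcos : Integrable (fun y => Real.cos ⟪y, (Real.pi * w) • (x u - x v)⟫) (stdGaussian H) :=
    Integrable.of_bound (by fun_prop) 1 (.of_forall fun y => Real.abs_cos_le_one _)
  have hI : ∫ y, (1 - Real.cos ⟪y, (Real.pi * w) • (x u - x v)⟫) / Real.pi ∂(stdGaussian H) =
      (1 - Real.exp (-(Real.pi ^ 2 * w ^ 2 * ‖x u - x v‖ ^ 2 / 2))) / Real.pi := by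
    rw [integral_div, integral_sub (integrable_const _) hcos, integral_cos_inner_stdGaussian,
      norm_smul, mul_pow, Real.norm_eq_abs, sq_abs, mul_pow]
    simp
  have hint : Integrable
      (fun y => (1 - Real.cos ⟪y, (Real.pi * w) • (x u - x v)⟫) / Real.pi) (stdGaussian H) :=
    ((integrable_const _).sub hcos).div_const _
  rw [measureReal_def, ← hI, ← ENNReal.ofReal_le_iff_le_toReal (measure_ne_top _ _),
    ofReal_integral_eq_lintegral_ofReal hint
      (.of_forall fun y => div_nonneg (sub_nonneg.2 (Real.cos_le_one _)) Real.pi_pos.le),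
    gaussianShift_parityAssignment_apply x w (fun ω => ω u ≠ ω v)]
  refine lintegral_mono fun y => ?_
  have := le_volume_floor_add_parity_ne ⟪y, w • x u⟫ ⟪y, w • x v⟫
  rw [← inner_sub_right, ← smul_sub, ← inner_smul_right,
    smul_smul] at this
  simpa only [parityAssignment, ne_eq, decide_eq_decide] using this

theorem gaussianShift_parityAssignment_ne_le {V : Type*} [Finite V] (x : V → H) {w d l : ℝ}
    (hw : 0 < w) (hl : 0 < l) (e : Finset V) (he : e.Nonempty)
    (hd : ∀ u ∈ e, ∀ v ∈ e, ‖x u - x v‖ ≤ d) :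
    (gaussianShift H).real
        {p | ∃ u ∈ e, ∃ v ∈ e, parityAssignment x w p u ≠ parityAssignment x w p v} ≤
      w * (2 * Real.log e.card + l ^ 2 * d ^ 2 / 2) / l := by
  set c : ℝ := 2 * Real.log e.card + l ^ 2 * d ^ 2 / 2 with hc
  set E : H → ℝ := fun y => ∑ u ∈ e, ∑ v ∈ e, Real.exp ⟪y, l • (x u - x v)⟫ with hE
  have hEint : Integrable E (stdGaussian H) :=
    integrable_finsetSum _ fun u _ => integrable_finsetSum _ fun v _ =>
      integrable_exp_inner_stdGaussian _
  have hEle : ∫ y, E y ∂(stdGaussian H) ≤ Real.exp c := by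
    have hcard : (0 : ℝ) < e.card := by exact_mod_cast he.card_pos
    rw [hE, integral_finsetSum _ fun u _ => integrable_finsetSum _ fun v _ =>
      integrable_exp_inner_stdGaussian _]
    calc _ ≤ ∑ u ∈ e, ∑ v ∈ e, Real.exp (l ^ 2 * d ^ 2 / 2) := by
          refine Finset.sum_le_sum fun u hu => ?_
          rw [integral_finsetSum _ fun v _ => integrable_exp_inner_stdGaussian _]
          refine Finset.sum_le_sum fun v hv => ?_
          rw [integral_exp_inner_stdGaussian, norm_smul, mul_pow, Real.norm_eq_abs, sq_abs]
          have := hd u hu v hv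
          gcongr
      _ = Real.exp c := by
          rw [hc, Real.exp_add, two_mul, Real.exp_add, Real.exp_log hcard]
          simp only [Finset.sum_const, nsmul_eq_mul]
          ring
  set B : H → ℝ := fun y => w / l * (c - 1 + Real.exp (-c) * E y) with hB
  have hBint : Integrable B (stdGaussian H) :=
    ((integrable_const _).add (hEint.const_mul _)).const_mul _
  have hBle : ∫ y, B y ∂(stdGaussian H) ≤ w * c / l := by
    rw [hB, integral_const_mul, integral_add (integrable_const _) (hEint.const_mul _),
      integral_const_mul]
    have : Real.exp (-c) * ∫ y, E y ∂(stdGaussian H) ≤ 1 := by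
      rw [Real.exp_neg, inv_mul_le_iff₀ (Real.exp_pos _), mul_one]
      exact hEle
    rw [mul_div_right_comm]
    refine mul_le_mul_of_nonneg_left ?_ (by positivity)
    simp
    linarith
  have hc0 : 0 ≤ c := by
    have := Real.log_natCast_nonneg e.card
    positivity
  have hpair : ∀ y, ∀ u ∈ e, ∀ v ∈ e, ⟪y, w • x u⟫ - ⟪y, w • x v⟫ ≤ B y := by
    intro y u hu v hv
    have h1 : Real.exp ⟪y, l • (x u - x v)⟫ ≤ E y :=
      (Finset.single_le_sum (f := fun v => Real.exp ⟪y, l • (x u - x v)⟫)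
        (fun v _ => (Real.exp_pos _).le) hv).trans
      (Finset.single_le_sum (f := fun u => ∑ v ∈ e, Real.exp ⟪y, l • (x u - x v)⟫)
        (fun u _ => Finset.sum_nonneg fun v _ => (Real.exp_pos _).le) hu)
    have h2 := Real.add_one_le_exp (-c + ⟪y, l • (x u - x v)⟫)
    rw [Real.exp_add] at h2
    have h3 := mul_le_mul_of_nonneg_left h1 (Real.exp_pos (-c)).le
    have h4 : ⟪y, w • x u⟫ - ⟪y, w • x v⟫ = w / l * ⟪y, l • (x u - x v)⟫ := by
      rw [← inner_sub_right, ← smul_sub, inner_smul_right, inner_smul_right]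
      field_simp
    rw [h4]
    exact mul_le_mul_of_nonneg_left (by linarith) (by positivity)
  have hB0 : ∀ y, 0 ≤ B y := fun y => by
    obtain ⟨u, hu⟩ := he
    simpa using hpair y u hu u hu
  rw [measureReal_def, gaussianShift_parityAssignment_apply x w
    (fun ω => ∃ u ∈ e, ∃ v ∈ e, ω u ≠ ω v)]
  refine ENNReal.toReal_le_of_le_ofReal (by positivity)
    (le_trans ?_ (ENNReal.ofReal_le_ofReal hBle))
  rw [ofReal_integral_eq_lintegral_ofReal hBint (.of_forall hB0)]
  refine lintegral_mono fun y => ?_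
  obtain ⟨u₀, hu₀, hmin⟩ := e.exists_min_image (fun u => ⟪y, w • x u⟫) he
  obtain ⟨v₀, hv₀, hmax⟩ := e.exists_max_image (fun u => ⟪y, w • x u⟫) he
  refine le_trans (measure_mono ?_) ((volume_floor_add_ne_le (hmin v₀ hv₀)).trans
    (ENNReal.ofReal_le_ofReal (hpair y v₀ hv₀ u₀ hu₀)))
  rintro t ⟨⟨u, hu, v, hv, huv⟩, ht⟩
  refine ⟨fun heq => huv ?_, ht⟩
  have key : ∀ z ∈ e, ⌊⟪y, w • x z⟫ + t⌋ = ⌊⟪y, w • x u₀⟫ + t⌋ := fun z hz =>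
    le_antisymm ((Int.floor_mono (by linarith [hmax z hz])).trans heq.ge)
      (Int.floor_mono (by linarith [hmin z hz]))
  simp only [parityAssignment, key u hu, key v hv]

end Gaussian

end RandomParity

theorem stmt_4 : ∃ C : ℝ, 0 < C ∧
    ∀ (V : Type) [Fintype V] [DecidableEq V]
      (H : Type) [NormedAddCommGroup H] [InnerProductSpace ℝ H] [FiniteDimensional ℝ H]
      (x : V → H) (β : ℝ),
      (∀ u, ‖x u‖ = 1) →
      (∀ u v w : V, ‖x u - x w‖ ^ 2 ≤ ‖x u - x v‖ ^ 2 + ‖x v - x w‖ ^ 2) →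
      0 < β → β < 1 →
      ∃ ν : (V → Bool) → ℝ, IsProbDist ν ∧
        (∀ e : Finset V, 2 ≤ e.card →
          Pr ν (fun ω => ∃ u ∈ e, ∃ v ∈ e, ω u ≠ ω v) ≤
            C * (Real.sqrt β)⁻¹ * Real.sqrt (Real.logb 2 e.card) * maxDist x e) ∧
        (∀ u v : V, β ≤ ‖x u - x v‖ ^ 2 → (0.3 : ℝ) ≤ Pr ν (fun ω => ω u ≠ ω v)) := by
  refine ⟨2, two_pos, fun V _ _ H _ _ _ x β _ _ hβ _ => ?_⟩
  borelize H
  have hsβ : 0 < Real.sqrt β := Real.sqrt_pos.2 hβ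
  set w : ℝ := (Real.sqrt β)⁻¹ with hw
  have hw0 : 0 < w := inv_pos.2 hsβ
  have hprob : ∀ P : (V → Bool) → Prop,
      Pr (fun ω => (gaussianShift H).real {p | parityAssignment x w p = ω}) P =
        (gaussianShift H).real {p | P (parityAssignment x w p)} := fun P =>
    Pr_map_eq (gaussianShift H) (measurable_parityAssignment x w) P
  refine ⟨fun ω => (gaussianShift H).real {p | parityAssignment x w p = ω},
    ⟨fun ω => MeasureTheory.measureReal_nonneg, ?_⟩, fun e he => ?_, fun u v huv => ?_⟩
  · simpa [Pr] using hprob (fun _ => True)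
  · rw [hprob]
    have hne : e.Nonempty := Finset.card_pos.1 (by omega)
    have hd := fun u hu v hv => norm_sub_le_maxDist x e (u := u) (v := v) hu hv
    have hd0 : 0 ≤ maxDist x e := by
      obtain ⟨u, hu⟩ := hne
      exact (norm_nonneg _).trans (hd u hu u hu)
    rcases hd0.eq_or_lt with h0 | hpos
    · rw [← h0, mul_zero]
      refine le_of_eq ?_
      convert MeasureTheory.measureReal_empty
      rw [Set.eq_empty_iff_forall_notMem]
      rintro p ⟨u, hu, v, hv, huv⟩
      have hxuv : x u = x v := by
        rw [← sub_eq_zero, ← norm_le_zero_iff, h0]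
        exact hd u hu v hv
      exact huv (by simp only [parityAssignment, hxuv])
    · have hcard : (1 : ℝ) < e.card := by exact_mod_cast he
      have hlog : 0 < Real.log e.card := Real.log_pos hcard
      have hL : 0 < Real.sqrt (Real.log e.card) := Real.sqrt_pos.2 hlog
      have hsq : Real.sqrt (Real.log e.card) ^ 2 = Real.log e.card := Real.sq_sqrt hlog.le
      have hle : Real.sqrt (Real.log e.card) ≤ Real.sqrt (Real.logb 2 e.card) := by
        apply Real.sqrt_le_sqrt
        rw [Real.logb, le_div_iff₀ (Real.log_pos one_lt_two)]
        nlinarith [Real.log_two_lt_d9]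
      refine (gaussianShift_parityAssignment_ne_le x hw0
        (l := 2 * Real.sqrt (Real.log e.card) / maxDist x e) (by positivity) e hne hd).trans ?_
      calc _ = 2 * w * Real.sqrt (Real.log e.card) * maxDist x e := by
            rw [← hsq]
            field_simp
            ring_nf
            simp [Real.sqrt_sq hL.le]
            ring
        _ ≤ _ := by gcongr
  · rw [hprob]
    refine le_trans ?_ (le_gaussianShift_parityAssignment_ne x w u v)
    have hw2 : 1 ≤ w ^ 2 * ‖x u - x v‖ ^ 2 := by
      rw [hw, inv_pow, Real.sq_sqrt hβ.le, ← div_eq_inv_mul, le_div_iff₀ hβ, one_mul]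
      exact huv
    have hexp : Real.exp (-(Real.pi ^ 2 * w ^ 2 * ‖x u - x v‖ ^ 2 / 2)) ≤ 0.055 := by
      have h4 : -(Real.pi ^ 2 * w ^ 2 * ‖x u - x v‖ ^ 2 / 2) ≤ -3 := by
        nlinarith [Real.pi_gt_three]
      refine (Real.exp_le_exp.2 h4).trans ?_
      rw [show (-3 : ℝ) = (3 : ℕ) * (-1) by norm_num, Real.exp_nat_mul]
      calc Real.exp (-1) ^ 3 ≤ 0.37 ^ 3 := by
            gcongr
            linarith [Real.exp_neg_one_lt_d9]
        _ ≤ 0.055 := by norm_num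
    rw [le_div_iff₀ Real.pi_pos]
    linarith [Real.pi_lt_d4]

end
end

section
/- There exists an absolute constant C > 0 such that the following holds. For every finite set V with |V| = n ≥ 2, every family of vectors (ū)_{u∈V} of norm at most 1 in a finite-dimensional real inner product space satisfying the ℓ2²-triangle inequalities, every real m ≥ 4 and every β ∈ (0,1), there exists a random subset S ⊆ V that is an ℓ2–ℓ2² hypergraph m-orthogonal separator with separation threshold β, probability scale α ≥ 1/n, ℓ2²-distortion D_{ℓ2²} ≤ C·m, and ℓ2-distortion D_{ℓ2}(r) ≤ C·β^{-1/2}·√(log₂ r)·m·(log₂ m)·(log₂ log₂ m) for every integer r ≥ 2. -/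
open scoped Classical BigOperators RealInnerProductSpace

noncomputable section

/-- `ℓ2`–`ℓ2²` hypergraph `m`-orthogonal separator with `ℓ2`-distortion `Dl2 : ℕ → ℝ`,
`ℓ2²`-distortion `Dl22`, probability scale `α` and separation threshold `β`. -/
def IsL2L22Sep {V H : Type*} [Fintype V] [DecidableEq V]
    [NormedAddCommGroup H] [InnerProductSpace ℝ H]
    (x : V → H) (m β α Dl22 : ℝ) (Dl2 : ℕ → ℝ) (μ : Finset V → ℝ) : Prop :=
  (∀ u : V, Pr μ (fun S => u ∈ S) = α * ‖x u‖ ^ 2) ∧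
  (∀ u v : V, β * min (‖x u‖ ^ 2) (‖x v‖ ^ 2) ≤ ‖x u - x v‖ ^ 2 →
    Pr μ (fun S => u ∈ S ∧ v ∈ S) ≤ α * min (‖x u‖ ^ 2) (‖x v‖ ^ 2) / m) ∧
  (∀ e : Finset V, 2 ≤ e.card →
    Pr μ (fun S => Cuts S e) ≤
      α * Dl22 * maxDistSq x e + α * Dl2 e.card * minNorm x e * maxDist x e)

lemma Pr_nonneg {Ω : Type*} [Fintype Ω] {μ : Ω → ℝ} (hμ : IsProbDist μ) (P : Ω → Prop) :
    0 ≤ Pr μ P :=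
  Finset.sum_nonneg fun ω _ => by split_ifs <;> simp [hμ.1 ω]

lemma Pr_mono {Ω : Type*} [Fintype Ω] {μ : Ω → ℝ} (hμ : IsProbDist μ) {P Q : Ω → Prop}
    (h : ∀ ω, P ω → Q ω) : Pr μ P ≤ Pr μ Q := by
  refine Finset.sum_le_sum fun ω _ => ?_
  have := hμ.1 ω
  have := h ω
  split_ifs <;> simp_all

lemma Pr_le_one {Ω : Type*} [Fintype Ω] {μ : Ω → ℝ} (hμ : IsProbDist μ) (P : Ω → Prop) :
    Pr μ P ≤ 1 := by
  rw [← hμ.2]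
  refine Finset.sum_le_sum fun ω _ => ?_
  have := hμ.1 ω
  split_ifs <;> simp_all

lemma Pr_or_le {Ω : Type*} [Fintype Ω] {μ : Ω → ℝ} (hμ : IsProbDist μ) (P Q : Ω → Prop) :
    Pr μ (fun ω => P ω ∨ Q ω) ≤ Pr μ P + Pr μ Q := by
  unfold Pr
  rw [← Finset.sum_add_distrib]
  refine Finset.sum_le_sum fun ω _ => ?_
  have := hμ.1 ω
  split_ifs <;> simp_all

lemma Pr_eq_sum_mul {Ω : Type*} [Fintype Ω] (μ : Ω → ℝ) (P : Ω → Prop) [DecidablePred P] :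
    Pr μ P = ∑ ω, μ ω * (if P ω then 1 else 0) :=
  Finset.sum_congr rfl fun ω _ => by split_ifs <;> simp

lemma Pr_eq_zero {Ω : Type*} [Fintype Ω] (μ : Ω → ℝ) {P : Ω → Prop} (h : ∀ ω, ¬ P ω) :
    Pr μ P = 0 :=
  Finset.sum_eq_zero fun ω _ => if_neg (h ω)

/-- The mixture of the distributions `κ a` with weights `μ a`. -/
def distBind {A B : Type*} [Fintype A] (μ : A → ℝ) (κ : A → B → ℝ) : B → ℝ :=
  fun b => ∑ a, μ a * κ a b

/-- The image of a finite distribution under a map. -/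
def distMap {A B : Type*} [Fintype A] (f : A → B) (μ : A → ℝ) : B → ℝ :=
  fun b => ∑ a, if f a = b then μ a else 0

lemma Pr_distBind {A B : Type*} [Fintype A] [Fintype B] (μ : A → ℝ) (κ : A → B → ℝ)
    (P : B → Prop) : Pr (distBind μ κ) P = ∑ a, μ a * Pr (κ a) P := by
  simp only [Pr_eq_sum_mul, distBind, Finset.sum_mul, Finset.mul_sum]
  rw [Finset.sum_comm]
  simp only [mul_assoc]

lemma Pr_distMap {A B : Type*} [Fintype A] [Fintype B] (f : A → B) (μ : A → ℝ)
    (P : B → Prop) : Pr (distMap f μ) P = Pr μ (fun a => P (f a)) := by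
  simp only [Pr_eq_sum_mul, distMap, Finset.sum_mul]
  rw [Finset.sum_comm]
  refine Finset.sum_congr rfl fun a _ => ?_
  rw [Finset.sum_eq_single (f a)] <;> simp +contextual [eq_comm]

lemma IsProbDist.distBind {A B : Type*} [Fintype A] [Fintype B] {μ : A → ℝ} {κ : A → B → ℝ}
    (hμ : IsProbDist μ) (hκ : ∀ a, IsProbDist (κ a)) : IsProbDist (distBind μ κ) := by
  refine ⟨fun b => Finset.sum_nonneg fun a _ => mul_nonneg (hμ.1 a) ((hκ a).1 b), ?_⟩
  unfold _root_.distBind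
  rw [Finset.sum_comm]
  simp [← Finset.mul_sum, (hκ _).2, hμ.2]

lemma IsProbDist.distMap {A B : Type*} [Fintype A] [Fintype B] {μ : A → ℝ}
    (hμ : IsProbDist μ) (f : A → B) : IsProbDist (distMap f μ) := by
  refine ⟨fun b => Finset.sum_nonneg fun a _ => ?_, ?_⟩
  · split_ifs
    exacts [hμ.1 a, le_rfl]
  · unfold _root_.distMap
    rw [Finset.sum_comm]
    simp [hμ.2]

/-- A random variable with finitely many values has a finitely supported law. -/
lemma exists_dist_of_measure {Ω A : Type*} [MeasurableSpace Ω] (ρ : MeasureTheory.Measure Ω)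
    [MeasureTheory.IsProbabilityMeasure ρ] [Fintype A] (f : Ω → A)
    (hf : ∀ a, MeasurableSet (f ⁻¹' {a})) :
    ∃ μ : A → ℝ, IsProbDist μ ∧ ∀ P : A → Prop, Pr μ P = ρ.real {ω | P (f ω)} := by
  have key : ∀ P : A → Prop,
      Pr (fun a => ρ.real (f ⁻¹' {a})) P = ρ.real {ω | P (f ω)} := by
    intro P
    have h : {ω | P (f ω)} = ⋃ a ∈ Finset.univ.filter P, f ⁻¹' {a} := by
      ext ω
      simp
    rw [h, MeasureTheory.measureReal_biUnion_finset _ fun a _ => hf a]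
    · simp [Pr, Finset.sum_filter]
    · intro a _ b _ hab
      exact Disjoint.preimage f (by simpa using hab)
  refine ⟨fun a => ρ.real (f ⁻¹' {a}), ⟨fun a => MeasureTheory.measureReal_nonneg, ?_⟩, key⟩
  have := key fun _ => True
  simpa [Pr] using this

/-- Independent sampling: every finite `F` is contained in the sample with probability
`α ^ F.card`. -/
lemma exists_bernoulli_subset {V : Type*} [Fintype V] [DecidableEq V] {α : ℝ} (h0 : 0 ≤ α)
    (h1 : α ≤ 1) : ∃ μ : Finset V → ℝ, IsProbDist μ ∧
      ∀ F : Finset V, Pr μ (fun T => F ⊆ T) = α ^ F.card := by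
  have key : ∀ F : Finset V,
      Pr (fun T => α ^ T.card * (1 - α) ^ (Finset.univ \ T).card) (fun T => F ⊆ T)
        = α ^ F.card := by
    intro F
    have h := Finset.prod_add (fun _ : V => α) (fun v => if v ∈ F then 0 else 1 - α) Finset.univ
    have h2 : ∏ v : V, (α + if v ∈ F then 0 else 1 - α) = α ^ F.card := by
      rw [← Finset.prod_const, ← Finset.prod_subset (Finset.subset_univ F)]
      · exact Finset.prod_congr rfl fun v hv => by simp [hv]
      · intro v _ hv
        simp [hv]
    rw [← h2, h, Pr]
    simp only [Finset.powerset_univ]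
    refine Finset.sum_congr rfl fun T _ => ?_
    split_ifs with hFT
    · rw [Finset.prod_const, ← Finset.prod_const (s := Finset.univ \ T)]
      congr 1
      refine Finset.prod_congr rfl fun v hv => ?_
      rw [if_neg]
      intro hvF
      simp at hv
      exact hv (hFT hvF)
    · obtain ⟨v, hvF, hvT⟩ := Finset.not_subset.1 hFT
      have h0 : ∏ v ∈ Finset.univ \ T, (if v ∈ F then 0 else 1 - α) = 0 :=
        Finset.prod_eq_zero (i := v) (by simp [hvT]) (by simp [hvF])
      rw [h0, mul_zero]
  refine ⟨_, ⟨fun T => mul_nonneg (pow_nonneg h0 _) (pow_nonneg (by linarith) _), ?_⟩, key⟩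
  simpa [Pr] using key ∅

/-- A sparse, almost pairwise independent random subset. -/
lemma exists_sparse_subset (V : Type*) [Fintype V] [DecidableEq V] [Nonempty V] {M : ℝ}
    (hM : 1 ≤ M) : ∃ (μ : Finset V → ℝ) (α : ℝ), IsProbDist μ ∧ 0 < α ∧
      1 / (Fintype.card V : ℝ) ≤ α ∧ 1 ≤ α * M ∧
      (∀ a, Pr μ (fun T => a ∈ T) = α) ∧
      ∀ a b, a ≠ b → Pr μ (fun T => a ∈ T ∧ b ∈ T) ≤ α / M := by
  have hM0 : 0 < M := by linarith
  have hn : (0 : ℝ) < Fintype.card V := by exact_mod_cast Fintype.card_pos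
  rcases le_total (Fintype.card V : ℝ) M with h | h
  · have hu : IsProbDist (fun _ : V => 1 / (Fintype.card V : ℝ)) :=
      ⟨fun _ => by positivity, by simp⟩
    refine ⟨distMap (fun v : V => {v}) fun _ => 1 / (Fintype.card V : ℝ), 1 / Fintype.card V,
      hu.distMap _, by positivity, le_rfl, ?_, fun a => ?_, fun a b hab => ?_⟩
    · rw [one_div, inv_mul_eq_div, le_div_iff₀ hn]
      linarith
    · rw [Pr_distMap]
      simp [Pr]
    · rw [Pr_distMap, Pr_eq_zero]
      · positivity
      · rintro v ⟨ha, hb⟩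
        simp at ha hb
        exact hab (ha.trans hb.symm)
  · obtain ⟨μ, hμ, hF⟩ := exists_bernoulli_subset (V := V) (α := 1 / M) (by positivity)
      (by rw [div_le_one hM0]; exact hM)
    refine ⟨μ, 1 / M, hμ, by positivity, one_div_le_one_div_of_le hM0 h, ?_, fun a => ?_,
      fun a b hab => ?_⟩
    · rw [one_div, inv_mul_cancel₀ hM0.ne']
    · simpa using hF {a}
    · have := hF {a, b}
      rw [Finset.card_pair hab] at this
      simp only [Finset.insert_subset_iff, Finset.singleton_subset_iff] at this
      rw [this]
      apply le_of_eq
      field_simp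

/-- The sum `∑ ± w i` with signs given by `ε`. -/
def signedSum {d : ℕ} (w : Fin d → ℝ) (ε : Fin d → Bool) : ℝ :=
  ∑ i, if ε i then w i else -w i

lemma sum_signs_succ {d : ℕ} (f : (Fin (d + 1) → Bool) → ℝ) :
    ∑ ε, f ε = ∑ ε : Fin d → Bool, (f (Fin.cons true ε) + f (Fin.cons false ε)) := by
  rw [← (Fin.consEquiv fun _ : Fin (d + 1) => Bool).sum_comp f, Fintype.sum_prod_type]
  simp [Finset.sum_add_distrib, Fin.consEquiv]

lemma signedSum_cons {d : ℕ} (w : Fin (d + 1) → ℝ) (b : Bool) (ε : Fin d → Bool) :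
    signedSum w (Fin.cons b ε : Fin (d + 1) → Bool) =
      (if b then w 0 else -w 0) + signedSum (fun i => w i.succ) ε := by
  simp [signedSum, Fin.sum_univ_succ]

lemma sum_signedSum_sq {d : ℕ} (w : Fin d → ℝ) :
    ∑ ε, signedSum w ε ^ 2 = 2 ^ d * ∑ i, w i ^ 2 := by
  induction d with
  | zero => simp [signedSum]
  | succ d ih =>
    have h : ∀ ε : Fin d → Bool, signedSum w (Fin.cons true ε : Fin (d + 1) → Bool) ^ 2 +
        signedSum w (Fin.cons false ε : Fin (d + 1) → Bool) ^ 2 =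
        2 * w 0 ^ 2 + 2 * signedSum (fun i => w i.succ) ε ^ 2 := by
      intro ε
      simp only [signedSum_cons]
      simp
      ring
    simp only [sum_signs_succ, h, Finset.sum_add_distrib, ← Finset.mul_sum, ih,
      Fin.sum_univ_succ]
    simp
    ring

lemma sum_signedSum_pow_four_le {d : ℕ} (w : Fin d → ℝ) :
    ∑ ε, signedSum w ε ^ 4 ≤ 2 ^ d * (3 * (∑ i, w i ^ 2) ^ 2) := by
  induction d with
  | zero => simp [signedSum]
  | succ d ih =>
    have h : ∀ ε : Fin d → Bool, signedSum w (Fin.cons true ε : Fin (d + 1) → Bool) ^ 4 +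
        signedSum w (Fin.cons false ε : Fin (d + 1) → Bool) ^ 4 =
        2 * w 0 ^ 4 + 12 * w 0 ^ 2 * signedSum (fun i => w i.succ) ε ^ 2 +
          2 * signedSum (fun i => w i.succ) ε ^ 4 := by
      intro ε
      simp only [signedSum_cons]
      simp
      ring
    have ih' := ih fun i => w i.succ
    simp only [sum_signs_succ, h, Finset.sum_add_distrib, ← Finset.mul_sum, sum_signedSum_sq,
      Fin.sum_univ_succ]
    simp only [Finset.sum_const, Finset.card_univ, Fintype.card_fun, Fintype.card_bool,
      Fintype.card_fin, nsmul_eq_mul, Nat.cast_pow, Nat.cast_ofNat]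
    have : (0 : ℝ) ≤ 2 ^ d * w 0 ^ 4 := by positivity
    rw [pow_succ (2 : ℝ) d]
    linarith

lemma sum_exp_signedSum_le {d : ℕ} (w : Fin d → ℝ) :
    ∑ ε, Real.exp (signedSum w ε) ≤ 2 ^ d * Real.exp ((∑ i, w i ^ 2) / 2) := by
  induction d with
  | zero => simp [signedSum]
  | succ d ih =>
    have h : ∀ ε : Fin d → Bool,
        Real.exp (signedSum w (Fin.cons true ε : Fin (d + 1) → Bool)) +
        Real.exp (signedSum w (Fin.cons false ε : Fin (d + 1) → Bool)) =
        2 * Real.cosh (w 0) * Real.exp (signedSum (fun i => w i.succ) ε) := by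
      intro ε
      simp only [signedSum_cons, Real.exp_add, Real.cosh_eq]
      simp
      ring
    have ih' := ih fun i => w i.succ
    simp only [sum_signs_succ, h, ← Finset.mul_sum, Fin.sum_univ_succ]
    calc 2 * Real.cosh (w 0) * ∑ ε, Real.exp (signedSum (fun i => w i.succ) ε)
        ≤ 2 * Real.exp (w 0 ^ 2 / 2) *
          (2 ^ d * Real.exp ((∑ i : Fin d, w i.succ ^ 2) / 2)) := by
          gcongr
          exact Real.cosh_le_exp_half_sq _
      _ = _ := by
          rw [add_div, Real.exp_add]
          ring

lemma signedSum_smul {d : ℕ} (c : ℝ) (w : Fin d → ℝ) (ε : Fin d → Bool) :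
    signedSum (fun i => c * w i) ε = c * signedSum w ε := by
  simp only [signedSum, Finset.mul_sum]
  exact Finset.sum_congr rfl fun i _ => by split_ifs <;> ring

lemma signedSum_sub {d : ℕ} (w z : Fin d → ℝ) (ε : Fin d → Bool) :
    signedSum (fun i => w i - z i) ε = signedSum w ε - signedSum z ε := by
  simp only [signedSum, ← Finset.sum_sub_distrib]
  exact Finset.sum_congr rfl fun i _ => by split_ifs <;> ring

/-- Anticoncentration of Rademacher sums. -/
lemma le_sum_min_one_abs_signedSum {d : ℕ} (w : Fin d → ℝ) (hw : 1 ≤ ∑ i, w i ^ 2) :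
    2 ^ d * (1 / 4 : ℝ) ≤ ∑ ε, min 1 |signedSum w ε| := by
  set σ := ∑ i, w i ^ 2 with hσ
  have hpt : ∀ X : ℝ, X ^ 2 / σ - X ^ 4 / (4 * σ ^ 2) ≤ min 1 |X| := by
    intro X
    have hX : |X| ^ 2 = X ^ 2 := sq_abs X
    refine le_min ?_ ?_
    · have : X ^ 2 / σ - X ^ 4 / (4 * σ ^ 2) = 1 - (X ^ 2 / σ / 2 - 1) ^ 2 := by
        field_simp
        ring
      rw [this]
      linarith [sq_nonneg (X ^ 2 / σ / 2 - 1)]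
    · rcases le_total |X| 1 with h | h
      · have h1 : X ^ 2 / σ ≤ X ^ 2 := div_le_self (sq_nonneg X) hw
        have h2 : 0 ≤ X ^ 4 / (4 * σ ^ 2) := by positivity
        nlinarith [abs_nonneg X]
      · have : X ^ 2 / σ - X ^ 4 / (4 * σ ^ 2) = 1 - (X ^ 2 / σ / 2 - 1) ^ 2 := by
          field_simp
          ring
        rw [this]
        linarith [sq_nonneg (X ^ 2 / σ / 2 - 1)]
  refine le_trans ?_ (Finset.sum_le_sum fun ε _ => hpt (signedSum w ε))
  rw [Finset.sum_sub_distrib, ← Finset.sum_div, ← Finset.sum_div, sum_signedSum_sq, ← hσ,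
    mul_div_cancel_right₀ _ (by positivity)]
  have h4 := sum_signedSum_pow_four_le w
  rw [← hσ] at h4
  have : (∑ ε, signedSum w ε ^ 4) / (4 * σ ^ 2) ≤ 2 ^ d * (3 / 4) := by
    rw [div_le_iff₀ (by positivity)]
    linarith
  linarith

/-- Maximal inequality for Rademacher sums. -/
lemma exists_signedSum_max_bound {ι : Type*} {d : ℕ} (e : Finset ι) (he : 2 ≤ e.card)
    (w : ι → Fin d → ℝ) {M : ℝ} (hM : 0 ≤ M) (hw : ∀ u ∈ e, ∑ i, w u i ^ 2 ≤ M ^ 2) :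
    ∃ D : (Fin d → Bool) → ℝ, (∀ ε, ∀ u ∈ e, |signedSum (w u) ε| ≤ D ε) ∧
      ∑ ε, D ε ≤ 2 ^ d * (7 / 2 * M * √(Real.logb 2 e.card)) := by
  rcases hM.eq_or_lt with rfl | hM
  · refine ⟨fun _ => 0, fun ε u hu => ?_, by simp⟩
    have h0 : ∀ i, w u i = 0 := by
      have := (Finset.sum_eq_zero_iff_of_nonneg (fun i _ => sq_nonneg (w u i))).1
        (le_antisymm (by simpa using hw u hu) (Finset.sum_nonneg fun i _ => sq_nonneg (w u i)))
      simpa using this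
    simp [signedSum, h0]
  have hr : (2 : ℝ) ≤ e.card := by exact_mod_cast he
  set r : ℝ := (e.card : ℝ)
  set s := √(Real.logb 2 r) with hs
  have hL : 1 ≤ Real.logb 2 r := by
    rw [Real.le_logb_iff_rpow_le (by norm_num) (by linarith)]
    simpa using hr
  have hs1 : 1 ≤ s := Real.one_le_sqrt.2 hL
  have hs2 : s ^ 2 = Real.logb 2 r := Real.sq_sqrt (by linarith)
  have hexp : 2 * r ≤ Real.exp (2 * s ^ 2) := by
    rw [hs2, ← Real.log_le_iff_le_exp (by linarith), Real.log_mul (by norm_num) (by linarith)]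
    have h2 : Real.log r = Real.logb 2 r * Real.log 2 := by
      rw [Real.logb, div_mul_cancel₀]
      exact (Real.log_pos (by norm_num)).ne'
    have := Real.log_two_lt_d9
    have := Real.log_pos (x := 2) (by norm_num)
    rw [h2]
    nlinarith
  set l := s / M with hl
  have hl0 : 0 < l := by positivity
  set A := 2 * M * s + M * s / 2 with hA
  have hlA : l * A = 2 * s ^ 2 + s ^ 2 / 2 := by
    rw [hl, hA]
    field_simp
  refine ⟨fun ε => A + Real.exp (-(l * A)) / l * ∑ u ∈ e,
    (Real.exp (l * signedSum (w u) ε) + Real.exp (-l * signedSum (w u) ε)), ?_, ?_⟩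
  · intro ε u hu
    have h1 : Real.exp (l * |signedSum (w u) ε|) ≤ ∑ u ∈ e,
        (Real.exp (l * signedSum (w u) ε) + Real.exp (-l * signedSum (w u) ε)) := by
      refine le_trans ?_ (Finset.single_le_sum (f := fun u =>
        Real.exp (l * signedSum (w u) ε) + Real.exp (-l * signedSum (w u) ε))
        (fun v _ => by positivity) hu)
      rcases abs_choice (signedSum (w u) ε) with h | h <;> rw [h]
      · linarith [Real.exp_pos (-l * signedSum (w u) ε)]
      · rw [mul_neg, ← neg_mul]
        linarith [Real.exp_pos (l * signedSum (w u) ε)]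
    have h2 : l * |signedSum (w u) ε| - l * A ≤
        Real.exp (-(l * A)) * Real.exp (l * |signedSum (w u) ε|) := by
      rw [← Real.exp_add]
      have := Real.add_one_le_exp (-(l * A) + l * |signedSum (w u) ε|)
      linarith
    have h3 : |signedSum (w u) ε| - A ≤
        Real.exp (-(l * A)) / l * Real.exp (l * |signedSum (w u) ε|) := by
      rw [div_mul_eq_mul_div, le_div_iff₀ hl0]
      linarith
    have h4 := mul_le_mul_of_nonneg_left h1 (show 0 ≤ Real.exp (-(l * A)) / l by positivity)
    linarith
  · have hE : ∀ c : ℝ, c ^ 2 = l ^ 2 → ∀ u ∈ e,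
        ∑ ε, Real.exp (c * signedSum (w u) ε) ≤ 2 ^ d * Real.exp (s ^ 2 / 2) := by
      intro c hc u hu
      simp only [← signedSum_smul]
      refine (sum_exp_signedSum_le _).trans ?_
      gcongr
      simp only [mul_pow, ← Finset.mul_sum, hc]
      calc l ^ 2 * ∑ i, w u i ^ 2 ≤ l ^ 2 * M ^ 2 := by
            gcongr
            exact hw u hu
        _ = s ^ 2 := by
            rw [hl]
            field_simp
    have hsum : ∑ ε, ∑ u ∈ e,
        (Real.exp (l * signedSum (w u) ε) + Real.exp (-l * signedSum (w u) ε)) ≤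
        2 ^ d * (2 * r * Real.exp (s ^ 2 / 2)) := by
      rw [Finset.sum_comm]
      calc _ ≤ ∑ u ∈ e, (2 ^ d * Real.exp (s ^ 2 / 2) + 2 ^ d * Real.exp (s ^ 2 / 2)) := by
            refine Finset.sum_le_sum fun u hu => ?_
            rw [Finset.sum_add_distrib]
            exact add_le_add (hE l rfl u hu) (hE (-l) (by ring) u hu)
        _ = _ := by
            rw [Finset.sum_const, nsmul_eq_mul]
            ring
    rw [Finset.sum_add_distrib, ← Finset.mul_sum]
    have h5 : Real.exp (-(l * A)) * (2 * r * Real.exp (s ^ 2 / 2)) ≤ 1 := by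
      calc _ ≤ Real.exp (-(l * A)) * (Real.exp (2 * s ^ 2) * Real.exp (s ^ 2 / 2)) := by gcongr
        _ = 1 := by
          rw [← Real.exp_add, ← Real.exp_add, hlA]
          simp
    have h6 : 1 / l ≤ M * s := by
      rw [div_le_iff₀ hl0, hl]
      field_simp
      nlinarith
    calc _ ≤ 2 ^ d * A + Real.exp (-(l * A)) / l * (2 ^ d * (2 * r * Real.exp (s ^ 2 / 2))) := by
          gcongr
          simp
      _ = 2 ^ d * (A + (1 / l) * (Real.exp (-(l * A)) * (2 * r * Real.exp (s ^ 2 / 2)))) := by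
          ring
      _ ≤ 2 ^ d * (A + (M * s) * 1) := by gcongr
      _ = _ := by
          rw [hA]
          ring

/-- The uniform measure on `[0, 1)`. -/
abbrev unifIco : MeasureTheory.Measure ℝ := MeasureTheory.volume.restrict (Set.Ico 0 1)

instance : MeasureTheory.IsProbabilityMeasure unifIco := ⟨by simp⟩

lemma floor_add_eq {a s : ℝ} (hs : s ∈ Set.Ico (0 : ℝ) 1) :
    (⌊a + s⌋ : ℝ) = ⌊a⌋ + (Set.Ici (1 - Int.fract a)).indicator 1 s := by
  have h1 := Int.floor_add_fract a
  have h2 := Int.fract_nonneg a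
  have h3 := Int.fract_lt_one a
  obtain ⟨hs0, hs1⟩ := hs
  by_cases h : 1 - Int.fract a ≤ s
  · have : ⌊a + s⌋ = ⌊a⌋ + 1 := by
      rw [Int.floor_eq_iff]
      push_cast
      constructor <;> linarith
    rw [this, Set.indicator_of_mem (by simpa using h)]
    simp
  · have : ⌊a + s⌋ = ⌊a⌋ := by
      rw [Int.floor_eq_iff]
      constructor <;> linarith
    rw [this, Set.indicator_of_notMem (by simpa using h)]
    simp

lemma floor_add_ae_eq (a : ℝ) : (fun s : ℝ => (⌊a + s⌋ : ℝ)) =ᵐ[unifIco]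
    fun s => ⌊a⌋ + (Set.Ici (1 - Int.fract a)).indicator 1 s :=
  (MeasureTheory.ae_restrict_iff' measurableSet_Ico).2 (.of_forall fun _ hs => floor_add_eq hs)

lemma integrable_floor_add (a : ℝ) :
    MeasureTheory.Integrable (fun s : ℝ => (⌊a + s⌋ : ℝ)) unifIco := by
  refine MeasureTheory.Integrable.congr ?_ (floor_add_ae_eq a).symm
  exact (MeasureTheory.integrable_const _).add
    ((MeasureTheory.integrable_const (1 : ℝ)).indicator measurableSet_Ici)

lemma integral_floor_add (a : ℝ) : ∫ s, (⌊a + s⌋ : ℝ) ∂unifIco = a := by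
  have hint : MeasureTheory.Integrable ((Set.Ici (1 - Int.fract a)).indicator 1) unifIco :=
    (MeasureTheory.integrable_const (1 : ℝ)).indicator measurableSet_Ici
  rw [MeasureTheory.integral_congr_ae (floor_add_ae_eq a),
    MeasureTheory.integral_add (MeasureTheory.integrable_const _) hint,
    MeasureTheory.integral_indicator_one measurableSet_Ici]
  have h2 := Int.fract_nonneg a
  have h3 := Int.fract_lt_one a
  have : Set.Ici (1 - Int.fract a) ∩ Set.Ico 0 1 = Set.Ico (1 - Int.fract a) 1 := by
    ext s
    simp only [Set.mem_inter_iff, Set.mem_Ici, Set.mem_Ico]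
    constructor
    · rintro ⟨h, -, h'⟩
      exact ⟨h, h'⟩
    · rintro ⟨h, h'⟩
      exact ⟨h, by linarith, h'⟩
  rw [MeasureTheory.measureReal_restrict_apply measurableSet_Ici, this]
  simp [Int.floor_add_fract, h2]

lemma measurableSet_floor_add_ne (a b : ℝ) : MeasurableSet {s : ℝ | ⌊a + s⌋ ≠ ⌊b + s⌋} := by
  have h : ∀ c : ℝ, Measurable fun s : ℝ => ⌊c + s⌋ := fun c => (measurable_const_add c).floor
  exact (measurableSet_eq_fun (h a) (h b)).compl

lemma measureReal_floor_add_ne_le {a b : ℝ} (hab : a ≤ b) :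
    unifIco.real {s | ⌊a + s⌋ ≠ ⌊b + s⌋} ≤ b - a := by
  rw [← MeasureTheory.integral_indicator_one (measurableSet_floor_add_ne a b)]
  calc _ ≤ ∫ s, ((⌊b + s⌋ : ℝ) - ⌊a + s⌋) ∂unifIco := by
        refine MeasureTheory.integral_mono
          ((MeasureTheory.integrable_const (1 : ℝ)).indicator (measurableSet_floor_add_ne a b))
          ((integrable_floor_add b).sub (integrable_floor_add a)) fun s => ?_
        have hle : ⌊a + s⌋ ≤ ⌊b + s⌋ := Int.floor_mono (by linarith)
        by_cases h : ⌊a + s⌋ ≠ ⌊b + s⌋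
        · rw [Set.indicator_of_mem (by exact h)]
          have : ⌊a + s⌋ + 1 ≤ ⌊b + s⌋ := by omega
          have : (⌊a + s⌋ : ℝ) + 1 ≤ ⌊b + s⌋ := by exact_mod_cast this
          simp
          linarith
        · rw [Set.indicator_of_notMem (by exact h)]
          have : (⌊a + s⌋ : ℝ) ≤ ⌊b + s⌋ := by exact_mod_cast hle
          simp
          linarith
    _ = b - a := by
        rw [MeasureTheory.integral_sub (integrable_floor_add b) (integrable_floor_add a),
          integral_floor_add, integral_floor_add]

lemma le_measureReal_floor_add_ne (a b : ℝ) :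
    min 1 (b - a) ≤ unifIco.real {s | ⌊a + s⌋ ≠ ⌊b + s⌋} := by
  rcases le_total 1 (b - a) with h1 | h1
  · have : {s | ⌊a + s⌋ ≠ ⌊b + s⌋} = Set.univ := by
      refine Set.eq_univ_of_forall fun s => ?_
      have : ⌊a + s + 1⌋ ≤ ⌊b + s⌋ := Int.floor_mono (by linarith)
      rw [Int.floor_add_one] at this
      exact (by omega : ⌊a + s⌋ ≠ ⌊b + s⌋)
    rw [this]
    simp
  · rw [← MeasureTheory.integral_indicator_one (measurableSet_floor_add_ne a b), min_eq_right h1]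
    calc b - a = ∫ s, ((⌊b + s⌋ : ℝ) - ⌊a + s⌋) ∂unifIco := by
          rw [MeasureTheory.integral_sub (integrable_floor_add b) (integrable_floor_add a),
            integral_floor_add, integral_floor_add]
      _ ≤ _ := by
          refine MeasureTheory.integral_mono
            ((integrable_floor_add b).sub (integrable_floor_add a))
            ((MeasureTheory.integrable_const (1 : ℝ)).indicator (measurableSet_floor_add_ne a b))
            fun s => ?_
          have hle : ⌊b + s⌋ ≤ ⌊a + s + 1⌋ := Int.floor_mono (by linarith)
          rw [Int.floor_add_one] at hle
          have hle' : (⌊b + s⌋ : ℝ) ≤ ⌊a + s⌋ + 1 := by exact_mod_cast hle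
          by_cases h : ⌊a + s⌋ ≠ ⌊b + s⌋
          · rw [Set.indicator_of_mem (by exact h)]
            simp
            linarith
          · rw [Set.indicator_of_notMem (by exact h)]
            simp at h
            simp [h]

/-- A colouring of `V` by elements of `V` with the same colour classes as `f`. -/
def classRep {V W : Type*} (f : V → W) (u : V) : V :=
  haveI : Nonempty V := ⟨u⟩
  Function.invFun f (f u)

lemma classRep_eq_iff {V W : Type*} (f : V → W) (u v : V) :
    classRep f u = classRep f v ↔ f u = f v := by
  have key : ∀ u, f (classRep f u) = f u := fun u =>
    haveI : Nonempty V := ⟨u⟩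
    Function.invFun_eq ⟨u, rfl⟩
  refine ⟨fun h => by rw [← key u, h, key v], fun h => ?_⟩
  simp only [classRep, h]

/-- `c` is not constant on `e`. -/
def Splits {V W : Type*} (c : V → W) (e : Finset V) : Prop :=
  ∃ u ∈ e, ∃ v ∈ e, c u ≠ c v

/-- The partition of the line into randomly shifted unit intervals. -/
lemma exists_line_partition {V : Type*} [Fintype V] [DecidableEq V] (a : V → ℝ) :
    ∃ ν : (V → V) → ℝ, IsProbDist ν ∧
      (∀ u v, Pr ν (fun c => c u = c v) ≤ 1 - min 1 |a u - a v|) ∧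
      ∀ (e : Finset V) (w : V) (D : ℝ), (∀ u ∈ e, |a u - a w| ≤ D) →
        0 ≤ D → Pr ν (fun c => Splits c e) ≤ 2 * D := by
  have hmeas : Measurable fun (s : ℝ) (u : V) => ⌊a u + s⌋ :=
    measurable_pi_lambda _ fun u => (measurable_const_add (a u)).floor
  obtain ⟨ν, hν, hP⟩ := exists_dist_of_measure unifIco
    (fun s => classRep fun u => ⌊a u + s⌋) fun c =>
      hmeas (MeasurableSet.of_discrete (s := classRep ⁻¹' {c}))
  refine ⟨ν, hν, fun u v => ?_, fun e w D hD hD0 => ?_⟩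
  · rw [hP]
    simp only [classRep_eq_iff]
    wlog huv : a u ≤ a v generalizing u v
    · have := this v u (le_of_not_ge huv)
      rw [abs_sub_comm]
      simpa only [eq_comm] using this
    have h := le_measureReal_floor_add_ne (a u) (a v)
    have h2 := MeasureTheory.measureReal_compl (μ := unifIco)
      (measurableSet_floor_add_ne (a u) (a v))
    have h3 : {s : ℝ | ⌊a u + s⌋ ≠ ⌊a v + s⌋}ᶜ = {s | ⌊a u + s⌋ = ⌊a v + s⌋} := by
      ext s
      simp
    rw [h3, MeasureTheory.probReal_univ] at h2
    rw [h2, abs_sub_comm, abs_of_nonneg (by linarith)]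
    linarith
  · rw [hP]
    refine le_trans (MeasureTheory.measureReal_mono
      (s₂ := {s | ⌊a w - D + s⌋ ≠ ⌊a w + D + s⌋}) ?_)
      ((measureReal_floor_add_ne_le (by linarith)).trans (by linarith))
    rintro s ⟨u, hu, v, hv, huv⟩
    rw [Ne, classRep_eq_iff] at huv
    intro h
    have key : ∀ z ∈ e, ⌊a z + s⌋ = ⌊a w - D + s⌋ := by
      intro z hz
      have := abs_le.1 (hD z hz)
      refine le_antisymm ?_ (Int.floor_mono (by linarith))
      rw [h]
      exact Int.floor_mono (by linarith)
    exact huv ((key u hu).trans (key v hv).symm)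

/-- One random projection followed by a randomly shifted grid of scale `κ⁻¹`. -/
lemma exists_projection_partition {V H : Type*} [Fintype V] [DecidableEq V]
    [NormedAddCommGroup H] [InnerProductSpace ℝ H] [FiniteDimensional ℝ H] (y : V → H)
    {κ : ℝ} (hκ : 0 ≤ κ) :
    ∃ ν : (V → V) → ℝ, IsProbDist ν ∧
      (∀ u v, 1 ≤ κ * ‖y u - y v‖ → Pr ν (fun c => c u = c v) ≤ 3 / 4) ∧
      ∀ e : Finset V, 2 ≤ e.card → ∀ M : ℝ, 0 ≤ M → (∀ u ∈ e, ∀ v ∈ e, ‖y u - y v‖ ≤ M) →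
        Pr ν (fun c => Splits c e) ≤ 7 * κ * M * √(Real.logb 2 e.card) := by
  set d := Module.finrank ℝ H
  set b := stdOrthonormalBasis ℝ H
  set w : V → Fin d → ℝ := fun u i => κ * ⟪b i, y u⟫
  have hw : ∀ u v, ∑ i, (w u i - w v i) ^ 2 = (κ * ‖y u - y v‖) ^ 2 := by
    intro u v
    simp only [w, ← mul_sub, ← inner_sub_right, mul_pow, ← Finset.mul_sum]
    rw [← b.sum_sq_norm_inner_right (y u - y v)]
    simp only [Real.norm_eq_abs, sq_abs]
    rfl
  choose ν hν hsep hcut using fun ε : Fin d → Bool =>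
    exists_line_partition fun u => signedSum (w u) ε
  have hunif : IsProbDist fun _ : Fin d → Bool => ((2 : ℝ) ^ d)⁻¹ :=
    ⟨fun _ => by positivity, by simp⟩
  have hpow : ((2 : ℝ) ^ d)⁻¹ * 2 ^ d = 1 := inv_mul_cancel₀ (by positivity)
  refine ⟨_, hunif.distBind hν, fun u v huv => ?_, fun e he M hM hyM => ?_⟩
  · rw [Pr_distBind, ← Finset.mul_sum]
    have h1 : ∑ ε, Pr (ν ε) (fun c => c u = c v) ≤
        ∑ ε, (1 - min 1 |signedSum (fun i => w u i - w v i) ε|) := by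
      refine Finset.sum_le_sum fun ε _ => ?_
      rw [signedSum_sub]
      exact hsep ε u v
    have h2 := le_sum_min_one_abs_signedSum (fun i => w u i - w v i) (by
      rw [hw]
      exact one_le_pow₀ huv)
    rw [Finset.sum_sub_distrib] at h1
    simp only [Finset.sum_const, Finset.card_univ, Fintype.card_fun, Fintype.card_bool,
      Fintype.card_fin, nsmul_eq_mul, Nat.cast_pow, Nat.cast_ofNat, mul_one] at h1
    calc _ ≤ ((2 : ℝ) ^ d)⁻¹ * (2 ^ d * (3 / 4)) := by
          gcongr
          linarith
      _ = 3 / 4 := by rw [← mul_assoc, hpow, one_mul]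
  · obtain ⟨z, hz⟩ : e.Nonempty := Finset.card_pos.1 (by omega)
    obtain ⟨D, hD, hDsum⟩ := exists_signedSum_max_bound e he (fun u i => w u i - w z i)
      (M := κ * M) (by positivity) fun u hu => by
        rw [hw]
        gcongr
        exact hyM u hu z hz
    rw [Pr_distBind, ← Finset.mul_sum]
    have h1 : ∑ ε, Pr (ν ε) (fun c => Splits c e) ≤ ∑ ε, 2 * D ε := by
      refine Finset.sum_le_sum fun ε _ => hcut ε e z (D ε) (fun u hu => ?_)
        ((abs_nonneg _).trans (hD ε z hz))
      rw [← signedSum_sub]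
      exact hD ε u hu
    rw [← Finset.mul_sum] at h1
    calc _ ≤ ((2 : ℝ) ^ d)⁻¹ * (2 ^ d * (7 * κ * M * √(Real.logb 2 e.card))) := by
          gcongr
          linarith
      _ = _ := by rw [← mul_assoc, hpow, one_mul]

/-- Common refinement of `t` independent copies of a random partition. -/
lemma exists_iterated_partition {V : Type*} [Fintype V] [DecidableEq V] [Nonempty V]
    {ν : (V → V) → ℝ} (hν : IsProbDist ν) (t : ℕ) :
    ∃ ρ : (V → V) → ℝ, IsProbDist ρ ∧
      (∀ u v, Pr ρ (fun c => c u = c v) ≤ Pr ν (fun c => c u = c v) ^ t) ∧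
      ∀ e : Finset V, Pr ρ (fun c => Splits c e) ≤ t * Pr ν (fun c => Splits c e) := by
  induction t with
  | zero =>
    have hone : IsProbDist fun _ : Unit => (1 : ℝ) := ⟨fun _ => zero_le_one, by simp⟩
    have v₀ : V := Classical.arbitrary V
    have hρ := hone.distMap fun _ (_ : V) => v₀
    refine ⟨_, hρ, fun u v => ?_, fun e => ?_⟩
    · simpa using Pr_le_one hρ _
    · rw [Pr_distMap, Pr_eq_zero]
      · simp
      · simp [Splits]
  | succ t ih =>
    obtain ⟨ρ, hρ, hsep, hcut⟩ := ih
    refine ⟨distBind ρ fun c => distMap (fun c' => classRep fun u => (c u, c' u)) ν,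
      hρ.distBind fun c => hν.distMap _, fun u v => ?_, fun e => ?_⟩
    · rw [Pr_distBind]
      simp only [Pr_distMap, classRep_eq_iff, Prod.mk.injEq]
      have h : ∀ c : V → V, Pr ν (fun c' => c u = c v ∧ c' u = c' v) =
          (if c u = c v then 1 else 0) * Pr ν (fun c' => c' u = c' v) := by
        intro c
        by_cases h : c u = c v
        · simp only [h, true_and, if_true, one_mul]
        · simp [h, Pr]
      simp only [h, ← mul_assoc, ← Finset.sum_mul]
      rw [← Pr_eq_sum_mul ρ fun c => c u = c v, pow_succ]
      exact mul_le_mul_of_nonneg_right (hsep u v) (Pr_nonneg hν _)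
    · rw [Pr_distBind]
      simp only [Pr_distMap]
      have h : ∀ c : V → V, Pr ν (fun c' => Splits (classRep fun u => (c u, c' u)) e) ≤
          (if Splits c e then 1 else 0) + Pr ν (fun c' => Splits c' e) := by
        intro c
        have h1 : Pr ν (fun _ => Splits c e) ≤ if Splits c e then 1 else 0 := by
          split_ifs with hc
          · exact Pr_le_one hν _
          · simp [Pr, hc]
        refine le_trans ?_ (add_le_add_left h1 _)
        refine le_trans (Pr_mono hν ?_) (Pr_or_le hν _ _)
        rintro c' ⟨u, hu, v, hv, huv⟩
        rw [Ne, classRep_eq_iff, Prod.mk.injEq, not_and_or] at huv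
        rcases huv with huv | huv
        exacts [Or.inl ⟨u, hu, v, hv, huv⟩, Or.inr ⟨u, hu, v, hv, huv⟩]
      calc _ ≤ ∑ c, ρ c * ((if Splits c e then 1 else 0) + Pr ν (fun c' => Splits c' e)) :=
            Finset.sum_le_sum fun c _ => mul_le_mul_of_nonneg_left (h c) (hρ.1 c)
        _ = Pr ρ (fun c => Splits c e) + Pr ν (fun c' => Splits c' e) := by
            simp only [mul_add, Finset.sum_add_distrib, ← Finset.sum_mul, hρ.2, one_mul]
            rw [← Pr_eq_sum_mul]
        _ ≤ _ := by
            push_cast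
            linarith [hcut e]

/-- A random superlevel set of a function with values in `[0, 1]`. -/
lemma exists_superlevel_set {V : Type*} [Fintype V] [DecidableEq V] (g : V → ℝ)
    (hg0 : ∀ u, 0 ≤ g u) (hg1 : ∀ u, g u ≤ 1) :
    ∃ μ : Finset V → ℝ, IsProbDist μ ∧ (∀ u, Pr μ (fun R => u ∈ R) = g u) ∧
      ∀ (e : Finset V) (D : ℝ), 0 ≤ D → (∀ u ∈ e, ∀ v ∈ e, g u - g v ≤ D) →
        Pr μ (fun R => Cuts R e) ≤ D := by
  have hmeas : Measurable fun (s : ℝ) (u : V) => decide (s < g u) := by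
    refine measurable_pi_lambda _ fun u => ?_
    refine measurable_to_bool ?_
    have : (fun s : ℝ => decide (s < g u)) ⁻¹' {true} = Set.Iio (g u) := by
      ext s
      simp
    rw [this]
    exact measurableSet_Iio
  obtain ⟨μ, hμ, hP⟩ := exists_dist_of_measure unifIco
    (fun s => Finset.univ.filter fun u => decide (s < g u) = true) fun R =>
      hmeas (MeasurableSet.of_discrete
        (s := (fun p : V → Bool => Finset.univ.filter fun u => p u = true) ⁻¹' {R}))
  refine ⟨μ, hμ, fun u => ?_, fun e D hD0 hD => ?_⟩
  · rw [hP]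
    have : {s : ℝ | u ∈ Finset.univ.filter fun u => decide (s < g u) = true} =
        Set.Iio (g u) := by
      ext s
      simp
    rw [this, MeasureTheory.measureReal_restrict_apply measurableSet_Iio]
    have : Set.Iio (g u) ∩ Set.Ico 0 1 = Set.Ico 0 (g u) := by
      ext s
      have := hg1 u
      simp only [Set.mem_inter_iff, Set.mem_Iio, Set.mem_Ico]
      constructor
      · rintro ⟨h, h', -⟩
        exact ⟨h', h⟩
      · rintro ⟨h, h'⟩
        exact ⟨h', h, by linarith⟩
    rw [this]
    simp [hg0 u]
  · rw [hP]
    rcases e.eq_empty_or_nonempty with rfl | he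
    · simpa [Cuts] using hD0
    obtain ⟨z, hz, hzmin⟩ := Finset.exists_min_image e g he
    have hsub : {s : ℝ | Cuts (Finset.univ.filter fun u => decide (s < g u) = true) e} ⊆
        Set.Icc (g z) (g z + D) := by
      rintro s ⟨⟨u, hu⟩, ⟨v, hv⟩⟩
      simp at hu hv
      exact ⟨(hzmin v hv.1).trans hv.2, by linarith [hD u hu.1 z hz]⟩
    refine (MeasureTheory.measureReal_mono hsub).trans ?_
    rw [MeasureTheory.measureReal_restrict_apply measurableSet_Icc]
    refine (MeasureTheory.measureReal_mono Set.inter_subset_left (by simp)).trans ?_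
    simp [hD0]

/-- The separator `{u ∈ R | c u ∈ T}` built from independent `R`, `c` and `T`. -/
lemma exists_combined_separator {V : Type*} [Fintype V] [DecidableEq V]
    {μR μT : Finset V → ℝ} {ρ : (V → V) → ℝ} (hR : IsProbDist μR) (hρ : IsProbDist ρ)
    (hT : IsProbDist μT) {g : V → ℝ} (hg : ∀ u, Pr μR (fun R => u ∈ R) = g u) {α δ : ℝ}
    (hα : ∀ a, Pr μT (fun T => a ∈ T) = α)
    (hδ : ∀ a b, a ≠ b → Pr μT (fun T => a ∈ T ∧ b ∈ T) ≤ α * δ) (hα0 : 0 ≤ α) (hδ0 : 0 ≤ δ) :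
    ∃ μ : Finset V → ℝ, IsProbDist μ ∧ (∀ u, Pr μ (fun S => u ∈ S) = α * g u) ∧
      (∀ u v, Pr μ (fun S => u ∈ S ∧ v ∈ S) ≤
        α * min (g u) (g v) * (Pr ρ (fun c => c u = c v) + δ)) ∧
      ∀ e : Finset V, ∀ w ∈ e, Pr μ (fun S => Cuts S e) ≤
        Pr μR (fun R => Cuts R e) + g w * Pr ρ (fun c => Splits c e) := by
  refine ⟨distBind μR fun R => distBind ρ fun c =>
    distMap (fun T => Finset.univ.filter fun u => u ∈ R ∧ c u ∈ T) μT,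
    hR.distBind fun R => hρ.distBind fun c => hT.distMap _, fun u => ?_, fun u v => ?_,
    fun e w hw => ?_⟩
  all_goals simp only [Pr_distBind, Pr_distMap]
  · have h : ∀ (R : Finset V) (c : V → V),
        Pr μT (fun T => u ∈ Finset.univ.filter fun u => u ∈ R ∧ c u ∈ T) =
          (if u ∈ R then 1 else 0) * α := by
      intro R c
      rw [← hα (c u)]
      by_cases h : u ∈ R
      · simp only [Finset.mem_filter, Finset.mem_univ, h, true_and, if_true, one_mul]
      · simp [h, Pr]
    simp only [h, ← Finset.sum_mul, hρ.2, one_mul, ← mul_assoc]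
    rw [← Pr_eq_sum_mul, hg, mul_comm]
  · have h : ∀ (R : Finset V) (c : V → V),
        Pr μT (fun T => (u ∈ Finset.univ.filter fun u => u ∈ R ∧ c u ∈ T) ∧
          v ∈ Finset.univ.filter fun u => u ∈ R ∧ c u ∈ T) ≤
          (if u ∈ R ∧ v ∈ R then 1 else 0) * (α * ((if c u = c v then 1 else 0) + δ)) := by
      intro R c
      by_cases h : u ∈ R ∧ v ∈ R
      · simp only [Finset.mem_filter, Finset.mem_univ, h.1, h.2, true_and, and_self, if_true,
          one_mul]
        by_cases hc : c u = c v
        · simp only [hc, and_self, if_true, hα]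
          nlinarith
        · simpa [hc] using hδ _ _ hc
      · rw [if_neg h, zero_mul, Pr_eq_zero]
        simp only [Finset.mem_filter, Finset.mem_univ, true_and]
        tauto
    calc _ ≤ ∑ R, μR R * ∑ c, ρ c *
          ((if u ∈ R ∧ v ∈ R then 1 else 0) * (α * ((if c u = c v then 1 else 0) + δ))) :=
          Finset.sum_le_sum fun R _ => mul_le_mul_of_nonneg_left
            (Finset.sum_le_sum fun c _ => mul_le_mul_of_nonneg_left (h R c) (hρ.1 c)) (hR.1 R)
      _ = Pr μR (fun R => u ∈ R ∧ v ∈ R) * (α * (Pr ρ (fun c => c u = c v) + δ)) := by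
          rw [Pr_eq_sum_mul, Finset.sum_mul]
          refine Finset.sum_congr rfl fun R _ => ?_
          rw [mul_assoc]
          congr 1
          have h1 : Pr ρ (fun c => c u = c v) + δ =
              ∑ c, ρ c * ((if c u = c v then 1 else 0) + δ) := by
            simp only [mul_add, Finset.sum_add_distrib, ← Finset.sum_mul, hρ.2, one_mul]
            rw [← Pr_eq_sum_mul]
          rw [h1, Finset.mul_sum, Finset.mul_sum]
          exact Finset.sum_congr rfl fun c _ => by ring
      _ ≤ min (g u) (g v) * (α * (Pr ρ (fun c => c u = c v) + δ)) := by
          have := Pr_nonneg hρ fun c => c u = c v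
          gcongr
          rw [← hg, ← hg]
          exact le_min (Pr_mono hR fun R h => h.1) (Pr_mono hR fun R h => h.2)
      _ = _ := by ring
  · have h : ∀ (R : Finset V) (c : V → V),
        Pr μT (fun T => Cuts (Finset.univ.filter fun u => u ∈ R ∧ c u ∈ T) e) ≤
          (if Cuts R e then 1 else 0) +
            (if w ∈ R then 1 else 0) * (if Splits c e then 1 else 0) := by
      intro R c
      by_cases h1 : Cuts R e
      · refine (Pr_le_one hT _).trans ?_
        rw [if_pos h1]
        have : (0 : ℝ) ≤ (if w ∈ R then 1 else 0) * (if Splits c e then 1 else 0) := by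
          positivity
        linarith
      by_cases h2 : w ∈ R ∧ Splits c e
      · refine (Pr_le_one hT _).trans ?_
        simp [h1, h2.1, h2.2]
      · rw [Pr_eq_zero]
        · positivity
        · rintro T ⟨⟨u, hu⟩, ⟨v, hv⟩⟩
          simp only [Finset.mem_inter, Finset.mem_filter, Finset.mem_univ, true_and,
            Finset.mem_sdiff] at hu hv
          have hall : ∀ z ∈ e, z ∈ R := fun z hz => by
            by_contra hzR
            exact h1 ⟨⟨u, by simp [hu]⟩, ⟨z, by simp [hz, hzR]⟩⟩
          refine h2 ⟨hall w hw, u, hu.1, v, hv.1, fun huv => hv.2 ⟨hall v hv.1, ?_⟩⟩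
          rw [← huv]
          exact hu.2.2
    calc _ ≤ ∑ R, μR R * ∑ c, ρ c * ((if Cuts R e then 1 else 0) +
            (if w ∈ R then 1 else 0) * (if Splits c e then 1 else 0)) :=
          Finset.sum_le_sum fun R _ => mul_le_mul_of_nonneg_left
            (Finset.sum_le_sum fun c _ => mul_le_mul_of_nonneg_left (h R c) (hρ.1 c)) (hR.1 R)
      _ = ∑ R, μR R * ((if Cuts R e then 1 else 0) +
            (if w ∈ R then 1 else 0) * Pr ρ (fun c => Splits c e)) := by
          refine Finset.sum_congr rfl fun R _ => ?_
          congr 1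
          rw [Pr_eq_sum_mul ρ fun c => Splits c e]
          simp only [mul_add, Finset.sum_add_distrib, ← Finset.sum_mul, hρ.2, one_mul,
            Finset.mul_sum]
          congr 1
          exact Finset.sum_congr rfl fun c _ => by ring
      _ = _ := by
          rw [← hg, Pr_eq_sum_mul μR fun R => Cuts R e, Pr_eq_sum_mul μR fun R => w ∈ R,
            Finset.sum_mul, ← Finset.sum_add_distrib]
          exact Finset.sum_congr rfl fun R _ => by ring

lemma norm_normalize_sub_sq {H : Type*} [NormedAddCommGroup H] [InnerProductSpace ℝ H]
    {u v : H} (hu : u ≠ 0) (hv : v ≠ 0) :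
    ‖‖u‖⁻¹ • u - ‖v‖⁻¹ • v‖ ^ 2 * (‖u‖ * ‖v‖) = 2 * (‖u‖ * ‖v‖) - 2 * ⟪u, v⟫ := by
  have ha : ‖u‖ ≠ 0 := norm_ne_zero_iff.2 hu
  have hb : ‖v‖ ≠ 0 := norm_ne_zero_iff.2 hv
  rw [norm_sub_sq_real, norm_smul, norm_smul, real_inner_smul_left, real_inner_smul_right]
  simp only [norm_inv, norm_norm]
  field_simp
  ring

lemma min_mul_norm_normalize_sub_le {H : Type*} [NormedAddCommGroup H] [InnerProductSpace ℝ H]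
    {u v : H} (hu : u ≠ 0) (hv : v ≠ 0) {k : ℝ} (hk : 0 ≤ k) (hku : k ≤ ‖u‖) (hkv : k ≤ ‖v‖) :
    k * ‖‖u‖⁻¹ • u - ‖v‖⁻¹ • v‖ ≤ ‖u - v‖ := by
  refine (sq_le_sq₀ (by positivity) (norm_nonneg _)).1 ?_
  have h1 := norm_normalize_sub_sq hu hv
  have h2 := norm_sub_sq_real u v
  have h3 : k ^ 2 ≤ ‖u‖ * ‖v‖ := by nlinarith
  have h4 := mul_le_mul_of_nonneg_left h3 (sq_nonneg ‖‖u‖⁻¹ • u - ‖v‖⁻¹ • v‖)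
  rw [mul_pow]
  nlinarith [sq_nonneg (‖u‖ - ‖v‖)]

/-- Separated vectors stay separated after normalization. -/
lemma le_norm_normalize_sub_sq {H : Type*} [NormedAddCommGroup H] [InnerProductSpace ℝ H]
    {u v : H} (hu : u ≠ 0) (hv : v ≠ 0) (h1 : ⟪u, v⟫ ≤ ‖u‖ ^ 2) (h2 : ⟪u, v⟫ ≤ ‖v‖ ^ 2)
    {β : ℝ} (hβ0 : 0 < β) (hβ1 : β < 1)
    (hsep : β * min (‖u‖ ^ 2) (‖v‖ ^ 2) ≤ ‖u - v‖ ^ 2) :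
    β / 2 ≤ ‖‖u‖⁻¹ • u - ‖v‖⁻¹ • v‖ ^ 2 := by
  wlog hle : ‖v‖ ≤ ‖u‖ generalizing u v
  · rw [norm_sub_rev]
    refine this hv hu (by rwa [real_inner_comm]) (by rwa [real_inner_comm]) ?_ (le_of_not_ge hle)
    rwa [min_comm, norm_sub_rev]
  have ha : 0 < ‖u‖ := norm_pos_iff.2 hu
  have hb : 0 < ‖v‖ := norm_pos_iff.2 hv
  rw [min_eq_right (by gcongr), norm_sub_sq_real] at hsep
  have h3 := norm_normalize_sub_sq hu hv
  refine le_of_mul_le_mul_right ?_ (mul_pos ha hb)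
  rw [h3]
  generalize ‖u‖ = a at *
  generalize ‖v‖ = b at *
  generalize ⟪u, v⟫ = p at *
  rcases le_total b ((1 - β / 4) * a) with h | h
  · nlinarith [mul_le_mul_of_nonneg_left h hb.le]
  · have h4 : a - b ≤ β / 3 * b := by nlinarith
    have h5 : (a - b) ^ 2 ≤ (β / 3 * b) ^ 2 := pow_le_pow_left₀ (by linarith) h4 2
    have h6 : a ≤ 4 / 3 * b := by nlinarith
    have h7 : a * b ≤ 4 / 3 * b ^ 2 := by nlinarith
    have h8 : β * (a * b) ≤ β * (4 / 3 * b ^ 2) := by gcongr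
    have h9 : β ^ 2 * b ^ 2 ≤ β * b ^ 2 := by
      gcongr
      nlinarith
    nlinarith

lemma finite_pair_values {V : Type*} (e : Finset V) (f : V → V → ℝ) :
    {d : ℝ | ∃ u ∈ e, ∃ v ∈ e, d = f u v}.Finite := by
  refine ((e ×ˢ e).finite_toSet.image fun p => f p.1 p.2).subset ?_
  rintro d ⟨u, hu, v, hv, rfl⟩
  exact ⟨(u, v), by simp [hu, hv], rfl⟩

lemma le_maxDist {V H : Type*} [NormedAddCommGroup H] (x : V → H) {e : Finset V} {u v : V}
    (hu : u ∈ e) (hv : v ∈ e) : ‖x u - x v‖ ≤ maxDist x e :=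
  le_csSup (finite_pair_values e fun u v => ‖x u - x v‖).bddAbove ⟨u, hu, v, hv, rfl⟩

lemma minNorm_le {V H : Type*} [NormedAddCommGroup H] (x : V → H) {e : Finset V} {w : V}
    (hw : w ∈ e) : minNorm x e ≤ ‖x w‖ := by
  refine csInf_le ⟨0, ?_⟩ ⟨w, hw, rfl⟩
  rintro d ⟨u, -, rfl⟩
  exact norm_nonneg _

lemma exists_minNorm_eq {V H : Type*} [NormedAddCommGroup H] (x : V → H) {e : Finset V}
    (he : e.Nonempty) : ∃ w ∈ e, minNorm x e = ‖x w‖ := by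
  obtain ⟨w, hw, hmin⟩ := Finset.exists_min_image e (fun w => ‖x w‖) he
  refine ⟨w, hw, le_antisymm (minNorm_le x hw) (le_csInf ⟨_, w, hw, rfl⟩ ?_)⟩
  rintro d ⟨u, hu, rfl⟩
  exact hmin u hu

lemma exists_pow_three_quarters_le {m : ℝ} (hm : 4 ≤ m) :
    ∃ t : ℕ, (3 / 4 : ℝ) ^ t ≤ 1 / (2 * m) ∧ (t : ℝ) ≤ 6 * Real.logb 2 m := by
  have hL : 2 ≤ Real.logb 2 m := by
    rw [Real.le_logb_iff_rpow_le (by norm_num) (by linarith)]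
    norm_num
    exact hm
  have h2m : Real.logb 2 (2 * m) = 1 + Real.logb 2 m := by
    rw [Real.logb_mul (by norm_num) (by linarith), Real.logb_self_eq_one (by norm_num)]
  set k := ⌈Real.logb 2 (2 * m)⌉₊
  have hk1 : (k : ℝ) < Real.logb 2 (2 * m) + 1 := Nat.ceil_lt_add_one (by linarith)
  have hk2 : Real.logb 2 (2 * m) ≤ k := Nat.le_ceil _
  refine ⟨3 * k, ?_, ?_⟩
  · have h1 : 2 * m ≤ 2 ^ k := by
      rw [Real.logb_le_iff_le_rpow (by norm_num) (by linarith)] at hk2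
      exact_mod_cast hk2
    calc (3 / 4 : ℝ) ^ (3 * k) = ((3 / 4) ^ 3) ^ k := pow_mul _ _ _
      _ ≤ (1 / 2) ^ k := by
          gcongr
          norm_num
      _ = 1 / 2 ^ k := by rw [div_pow, one_pow]
      _ ≤ _ := by
          apply one_div_le_one_div_of_le (by linarith) h1
  · push_cast
    linarith

theorem stmt_5 : ∃ C : ℝ, 0 < C ∧
    ∀ (V : Type) [Fintype V] [DecidableEq V]
      (H : Type) [NormedAddCommGroup H] [InnerProductSpace ℝ H] [FiniteDimensional ℝ H]
      (x : V → H) (m β : ℝ),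
      2 ≤ Fintype.card V → (∀ u, ‖x u‖ ≤ 1) → L22 x →
      4 ≤ m → 0 < β → β < 1 →
      ∃ (μ : Finset V → ℝ) (α Dl22 : ℝ) (Dl2 : ℕ → ℝ), IsProbDist μ ∧
        1 / (Fintype.card V : ℝ) ≤ α ∧ 0 < α ∧
        Dl22 ≤ C * m ∧
        (∀ r : ℕ, 2 ≤ r →
          Dl2 r ≤ C * (Real.sqrt β)⁻¹ * Real.sqrt (Real.logb 2 r) * m *
                    Real.logb 2 m * Real.logb 2 (Real.logb 2 m)) ∧
        IsL2L22Sep x m β α Dl22 Dl2 μ := by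
  refine ⟨200, by norm_num, ?_⟩
  intro V _ _ H _ _ _ x m β hn hx hL22 hm hβ0 hβ1
  have : Nonempty V := Fintype.card_pos_iff.1 (by omega)
  obtain ⟨hV, hin⟩ := hL22
  have hsβ : 0 < √β := Real.sqrt_pos.2 hβ0
  set κ := 2 * (√β)⁻¹ with hκ
  obtain ⟨ν, hν, hνsep, hνcut⟩ :=
    exists_projection_partition (fun u => ‖x u‖⁻¹ • x u) (κ := κ) (by positivity)
  obtain ⟨t, htm, htlog⟩ := exists_pow_three_quarters_le hm
  obtain ⟨ρ, hρ, hρsep, hρcut⟩ := exists_iterated_partition hν t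
  obtain ⟨μR, hR, hRmem, hRcut⟩ := exists_superlevel_set (fun u => ‖x u‖ ^ 2)
    (fun u => sq_nonneg _) (fun u => pow_le_one₀ (norm_nonneg _) (hx u))
  obtain ⟨μT, α, hT, hα0, hαn, hαm, hTmem, hTpair⟩ :=
    exists_sparse_subset V (M := 2 * m) (by linarith)
  obtain ⟨μ, hμ, hmem, hpair, hcut⟩ := exists_combined_separator hR hρ hT hRmem hTmem
    (δ := 1 / (2 * m)) (fun a b hab => by simpa [div_eq_mul_inv] using hTpair a b hab)
    hα0.le (by positivity)
  have hlog : 2 ≤ Real.logb 2 m := by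
    rw [Real.le_logb_iff_rpow_le (by norm_num) (by linarith)]
    norm_num
    exact hm
  have hloglog : 1 ≤ Real.logb 2 (Real.logb 2 m) := by
    rw [Real.le_logb_iff_rpow_le (by norm_num) (by linarith)]
    simpa using hlog
  refine ⟨μ, α, 200 * m, fun r => 200 * (√β)⁻¹ * √(Real.logb 2 r) * m *
    Real.logb 2 m * Real.logb 2 (Real.logb 2 m), hμ, hαn, hα0, le_rfl, fun _ _ => le_rfl,
    hmem, fun u v huv => ?_, fun e he => ?_⟩
  · by_cases h0 : x u = 0 ∨ x v = 0
    · have hmin : min (‖x u‖ ^ 2) (‖x v‖ ^ 2) = 0 := by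
        rcases h0 with h | h <;> simp [h]
      simpa [hmin] using hpair u v
    push Not at h0
    have hd := le_norm_normalize_sub_sq h0.1 h0.2 (hin u v).2
      (by rw [real_inner_comm]; exact (hin v u).2) hβ0 hβ1 huv
    have hκd : 1 ≤ κ * ‖‖x u‖⁻¹ • x u - ‖x v‖⁻¹ • x v‖ := by
      refine (one_le_sq_iff₀ (by positivity)).1 ?_
      rw [mul_pow, hκ, mul_pow, inv_pow, Real.sq_sqrt hβ0.le]
      calc (1 : ℝ) ≤ 2 ^ 2 * β⁻¹ * (β / 2) := by
            field_simp
            norm_num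
        _ ≤ _ := by gcongr
    have hp : Pr ρ (fun c => c u = c v) ≤ 1 / (2 * m) :=
      (hρsep u v).trans ((pow_le_pow_left₀ (Pr_nonneg hν _) (hνsep u v hκd) t).trans htm)
    calc _ ≤ _ := hpair u v
      _ ≤ α * min (‖x u‖ ^ 2) (‖x v‖ ^ 2) * (1 / (2 * m) + 1 / (2 * m)) := by gcongr
      _ = _ := by
          field_simp
          ring
  · have hne : e.Nonempty := Finset.card_pos.1 (by omega)
    obtain ⟨w, hw, hwmin⟩ := exists_minNorm_eq x hne
    have hD0 : 0 ≤ maxDist x e := (norm_nonneg _).trans (le_maxDist x hw hw)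
    have hDS0 : 0 ≤ maxDistSq x e := (sq_nonneg _).trans (le_maxDistSq x hw hw)
    have hRe : Pr μR (fun R => Cuts R e) ≤ maxDistSq x e := by
      refine hRcut e _ hDS0 fun u hu v hv => le_trans ?_ (le_maxDistSq x hu hv)
      have h1 := norm_sub_sq_real (x u) (x v)
      have h2 := (hin v u).2
      rw [real_inner_comm] at h2
      linarith
    set s := √(Real.logb 2 e.card)
    have hs0 : 0 ≤ s := Real.sqrt_nonneg _
    have hsplit : ‖x w‖ ^ 2 * Pr ρ (fun c => Splits c e) ≤
        t * (7 * κ * s) * (‖x w‖ * maxDist x e) := by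
      rcases (norm_nonneg (x w)).eq_or_lt with h0 | h0
      · rw [← h0]
        simp
      have hpos : ∀ u ∈ e, ‖x w‖ ≤ ‖x u‖ := fun u hu => hwmin ▸ minNorm_le x hu
      have hnz : ∀ u ∈ e, x u ≠ 0 := fun u hu => norm_pos_iff.1 (h0.trans_le (hpos u hu))
      have h1 := hνcut e he (maxDist x e / ‖x w‖) (by positivity) fun u hu v hv => by
        rw [le_div_iff₀ h0, mul_comm]
        exact (min_mul_norm_normalize_sub_le (hnz u hu) (hnz v hv) h0.le (hpos u hu)
          (hpos v hv)).trans (le_maxDist x hu hv)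
      calc _ ≤ ‖x w‖ ^ 2 * (t * (7 * κ * (maxDist x e / ‖x w‖) * s)) := by
            gcongr
            refine (hρcut e).trans ?_
            gcongr
        _ = _ := by field_simp
    have hcoef : t * (7 * κ * s) ≤ α * (200 * (√β)⁻¹ * s * m *
        Real.logb 2 m * Real.logb 2 (Real.logb 2 m)) := by
      calc t * (7 * κ * s) ≤ 6 * Real.logb 2 m * (7 * κ * s) := by gcongr
        _ = 84 * ((√β)⁻¹ * s * Real.logb 2 m) := by
            rw [hκ]
            ring
        _ ≤ 100 * (α * (2 * m)) * ((√β)⁻¹ * s * Real.logb 2 m) := by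
            gcongr
            linarith
        _ ≤ 100 * (α * (2 * m)) * ((√β)⁻¹ * s * Real.logb 2 m) *
            Real.logb 2 (Real.logb 2 m) := le_mul_of_one_le_right (by positivity) hloglog
        _ = _ := by ring
    calc _ ≤ _ := hcut e w hw
      _ ≤ maxDistSq x e + α * (200 * (√β)⁻¹ * s * m *
          Real.logb 2 m * Real.logb 2 (Real.logb 2 m)) * (‖x w‖ * maxDist x e) := by
          refine add_le_add hRe (hsplit.trans ?_)
          gcongr
      _ ≤ _ := by
          rw [hwmin, mul_assoc _ ‖x w‖]
          gcongr
          refine le_mul_of_one_le_left hDS0 ?_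
          nlinarith

end
end
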